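/- arXiv:2503.05308 — 10 statements merged into one kernel-verified Lean document; each statement's English description precedes it below -/
import Mathlib

section
/- Let (X,d) be a compact metric space, μ a probability measure on X, ε > 0, and c : X×X → ℝ a continuous function such that |c(x,y) − c(x,y′)| ≤ L·d(y,y′) for all x,y,y′ ∈ X and some constant L > 0. Let α : X → ℝ be bounded and measurable, and define β : X → ℝ by β(y) := −ε·log(∫ exp((α(x) − c(x,y))/ε) dμ(x)). Then β is L-Lipschitz, i.e. |β(y) − β(y′)| ≤ L·d(y,y′) for all y, y′ ∈ X. -/
open MeasureTheory

/-- The log-integral-exp functional is monotone and commutes with adding constants. -/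
theorem log_integral_exp_le_add {X : Type*} [MeasurableSpace X] {μ : Measure X} [NeZero μ]
    {f g : X → ℝ} {K : ℝ} (hf : Integrable (fun x => Real.exp (f x)) μ)
    (hg : Integrable (fun x => Real.exp (g x)) μ) (hfg : ∀ x, f x ≤ g x + K) :
    Real.log (∫ x, Real.exp (f x) ∂μ) ≤ Real.log (∫ x, Real.exp (g x) ∂μ) + K := by
  have hle : ∫ x, Real.exp (f x) ∂μ ≤ (∫ x, Real.exp (g x) ∂μ) * Real.exp K := by
    rw [← integral_mul_const]
    refine integral_mono hf (hg.mul_const _) fun x => ?_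
    rw [← Real.exp_add]
    exact Real.exp_le_exp.2 (hfg x)
  calc Real.log (∫ x, Real.exp (f x) ∂μ)
      ≤ Real.log ((∫ x, Real.exp (g x) ∂μ) * Real.exp K) :=
        Real.log_le_log (integral_exp_pos hf) hle
    _ = Real.log (∫ x, Real.exp (g x) ∂μ) + K := by
        rw [Real.log_mul (integral_exp_pos hg).ne' (Real.exp_ne_zero _), Real.log_exp]

/-- The exponential of a measurable function bounded above is integrable for a finite measure. -/
theorem integrable_exp_of_measurable_of_le {X : Type*} [MeasurableSpace X] {μ : Measure X}
    [IsFiniteMeasure μ] {f : X → ℝ} (hf : Measurable f) {B : ℝ} (hB : ∀ x, f x ≤ B) :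
    Integrable (fun x => Real.exp (f x)) μ := by
  refine Integrable.of_bound hf.exp.aestronglyMeasurable (Real.exp B) (.of_forall fun x => ?_)
  rw [Real.norm_eq_abs, Real.abs_exp]
  exact Real.exp_le_exp.2 (hB x)

/-- **Lipschitz inheritance for entropic dual potentials.**
If `c` is uniformly `L`-Lipschitz in its second argument, `α` is bounded measurable,
and `β y = -ε log ∫ exp((α x - c(x,y))/ε) dμ(x)`, then `β` is `L`-Lipschitz. -/
theorem schroedinger_potential_lipschitz
    {X : Type*} [MetricSpace X] [CompactSpace X] [MeasurableSpace X] [BorelSpace X]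
    (μ : Measure X) [IsProbabilityMeasure μ]
    (ε : ℝ) (hε : 0 < ε)
    (c : X → X → ℝ) (hc : Continuous fun p : X × X => c p.1 p.2)
    (L : ℝ) (hL : 0 < L)
    (hcL : ∀ x y y', |c x y - c x y'| ≤ L * dist y y')
    (α : X → ℝ) (hαm : Measurable α) (hαb : ∃ M, ∀ x, |α x| ≤ M)
    (β : X → ℝ)
    (hβ : ∀ y, β y = -ε * Real.log (∫ x, Real.exp ((α x - c x y) / ε) ∂μ)) :
    ∀ y y', |β y - β y'| ≤ L * dist y y' := by
  obtain ⟨M, hM⟩ := hαb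
  have hint : ∀ y, Integrable (fun x => Real.exp ((α x - c x y) / ε)) μ := fun y => by
    have hcy : Continuous fun x => c x y := hc.comp (Continuous.prodMk_left y)
    obtain ⟨C, hC⟩ := isCompact_univ.bddBelow_image hcy.continuousOn
    refine integrable_exp_of_measurable_of_le (B := (M - C) / ε)
      ((hαm.sub hcy.measurable).div_const ε) fun x => ?_
    have hCx : C ≤ c x y := hC ⟨x, trivial, rfl⟩
    have hMx : α x ≤ M := (le_abs_self _).trans (hM x)
    gcongr
  have hle : ∀ y y', β y - β y' ≤ L * dist y y' := fun y y' => by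
    have h := log_integral_exp_le_add (K := L * dist y y' / ε) (hint y') (hint y) fun x => by
      rw [← add_div]
      gcongr
      linarith [(abs_le.1 (hcL x y y')).2]
    have h' := mul_le_mul_of_nonneg_left h hε.le
    rw [mul_add, mul_div_cancel₀ _ hε.ne'] at h'
    rw [hβ y, hβ y']
    linarith
  intro y y'
  exact abs_sub_le_iff.2 ⟨hle y y', dist_comm y y' ▸ hle y' y⟩
end

section
/- Let (X,d) be a compact metric space, ε > 0, c : X×X → ℝ continuous, μ, μ′, ν, ν′ probability measures on X, and π ∈ Π(μ,ν). Let k₁ be the entropic transport kernel of a Schrödinger pair for (μ′,μ) and k₂ the entropic transport kernel of a Schrödinger pair for (ν,ν′). Then the function (k₁ : π : k₂)(x′,y′) := ∫ k₁(x′,x)·k₂(y,y′) dπ(x,y) is continuous and nonnegative on X×X, satisfies ∫ (k₁ : π : k₂)(x′,y) dμ′(x′) = 1 and ∫ (k₁ : π : k₂)(x,y′) dν′(y′) = 1 for all x, y ∈ X, and the measure (k₁ : π : k₂)·(μ′⊗ν′) is a probability measure belonging to Π(μ′,ν′). -/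
open MeasureTheory
open scoped ENNReal

/-- A Schrödinger pair for `(μ, ν)` with cost `c` and regularization `ε`,
together with the associated entropic transport kernel
`k(x,y) = exp((α x + β y - c x y)/ε)` and its marginal normalizations. -/
def IsSchrodingerKernel {X : Type*} [MetricSpace X] [MeasurableSpace X]
    (ε : ℝ) (c : X → X → ℝ) (μ ν : Measure X) (k : X → X → ℝ) : Prop :=
  ∃ α β : X → ℝ, Continuous α ∧ Continuous β ∧
    (∀ x, α x = -ε * Real.log (∫ y, Real.exp ((β y - c x y) / ε) ∂ν)) ∧
    (∀ y, β y = -ε * Real.log (∫ x, Real.exp ((α x - c x y) / ε) ∂μ)) ∧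
    (∀ x y, k x y = Real.exp ((α x + β y - c x y) / ε)) ∧
    (∀ y, ∫ x, k x y ∂μ = 1) ∧ (∀ x, ∫ y, k x y ∂ν = 1)

/-- A jointly continuous kernel on a compact space is integrable in its second variable
against any finite measure. -/
theorem integrable_right_of_continuous {X Y : Type*} [TopologicalSpace X]
    [TopologicalSpace Y] [CompactSpace Y] [MeasurableSpace Y] [OpensMeasurableSpace Y]
    {f : X → Y → ℝ} (hf : Continuous fun p : X × Y => f p.1 p.2)
    (ν : Measure Y) [IsFiniteMeasure ν] (x : X) : Integrable (f x) ν :=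
  (hf.comp (Continuous.prodMk_right x)).integrable_of_hasCompactSupport
    (HasCompactSupport.of_compactSpace _)

/-- The first marginal of a measure whose density with respect to `μ ⊗ ν` is continuous,
nonnegative and integrates to one in the second variable is `μ`. -/
theorem map_fst_withDensity_prod {X Y : Type*} [TopologicalSpace X] [SecondCountableTopology X]
    [MeasurableSpace X] [BorelSpace X] [TopologicalSpace Y] [CompactSpace Y]
    [SecondCountableTopology Y] [MeasurableSpace Y] [BorelSpace Y]
    {f : X → Y → ℝ} (hf : Continuous fun p : X × Y => f p.1 p.2) (hf0 : ∀ x y, 0 ≤ f x y)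
    (μ : Measure X) (ν : Measure Y) [SFinite μ] [IsFiniteMeasure ν]
    (h : ∀ x, ∫ y, f x y ∂ν = 1) :
    ((μ.prod ν).withDensity fun p => ENNReal.ofReal (f p.1 p.2)).map Prod.fst = μ := by
  have hm : Measurable fun p : X × Y => ENNReal.ofReal (f p.1 p.2) :=
    hf.measurable.ennreal_ofReal
  ext s hs
  rw [Measure.map_apply measurable_fst hs, withDensity_apply _ (measurable_fst hs),
    ← Set.prod_univ, ← Measure.prod_restrict, Measure.restrict_univ,
    lintegral_prod _ hm.aemeasurable]
  have h1 (x : X) : ∫⁻ y, ENNReal.ofReal (f x y) ∂ν = 1 := by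
    rw [← ofReal_integral_eq_lintegral_ofReal (integrable_right_of_continuous hf ν x)
      (Filter.Eventually.of_forall (hf0 x)), h, ENNReal.ofReal_one]
  simp [h1]

/-- The second marginal of a measure whose density with respect to `μ ⊗ ν` is continuous,
nonnegative and integrates to one in the first variable is `ν`. -/
theorem map_snd_withDensity_prod {X Y : Type*} [TopologicalSpace X] [CompactSpace X]
    [SecondCountableTopology X] [MeasurableSpace X] [BorelSpace X] [TopologicalSpace Y]
    [SecondCountableTopology Y] [MeasurableSpace Y] [BorelSpace Y]
    {f : X → Y → ℝ} (hf : Continuous fun p : X × Y => f p.1 p.2) (hf0 : ∀ x y, 0 ≤ f x y)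
    (μ : Measure X) (ν : Measure Y) [IsFiniteMeasure μ] [SFinite ν]
    (h : ∀ y, ∫ x, f x y ∂μ = 1) :
    ((μ.prod ν).withDensity fun p => ENNReal.ofReal (f p.1 p.2)).map Prod.snd = ν := by
  have hm : Measurable fun p : X × Y => ENNReal.ofReal (f p.1 p.2) :=
    hf.measurable.ennreal_ofReal
  ext s hs
  rw [Measure.map_apply measurable_snd hs, withDensity_apply _ (measurable_snd hs),
    ← Set.univ_prod, ← Measure.prod_restrict, Measure.restrict_univ,
    lintegral_prod_symm _ hm.aemeasurable]
  have h1 (y : Y) : ∫⁻ x, ENNReal.ofReal (f x y) ∂μ = 1 := by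
    rw [← ofReal_integral_eq_lintegral_ofReal
      (integrable_right_of_continuous (f := fun y x => f x y) (hf.comp continuous_swap) μ y)
      (Filter.Eventually.of_forall fun x => hf0 x y), h, ENNReal.ofReal_one]
  simp [h1]

namespace IsSchrodingerKernel

variable {X : Type*} [MetricSpace X] [MeasurableSpace X] {ε : ℝ} {c : X → X → ℝ}
  {μ ν : Measure X} {k : X → X → ℝ}

theorem continuous (hk : IsSchrodingerKernel ε c μ ν k)
    (hc : Continuous fun p : X × X => c p.1 p.2) : Continuous fun p : X × X => k p.1 p.2 := by
  obtain ⟨α, β, hα, hβ, -, -, hk, -, -⟩ := hk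
  simp only [hk]
  fun_prop

theorem nonneg (hk : IsSchrodingerKernel ε c μ ν k) (x y : X) : 0 ≤ k x y := by
  obtain ⟨α, β, -, -, -, -, hk, -, -⟩ := hk
  rw [hk]
  positivity

theorem integral_left (hk : IsSchrodingerKernel ε c μ ν k) (y : X) : ∫ x, k x y ∂μ = 1 := by
  obtain ⟨_, _, -, -, -, -, -, h, -⟩ := hk
  exact h y

theorem integral_right (hk : IsSchrodingerKernel ε c μ ν k) (x : X) : ∫ y, k x y ∂ν = 1 := by
  obtain ⟨_, _, -, -, -, -, -, -, h⟩ := hk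
  exact h x

end IsSchrodingerKernel

/-- **The smoothed kernel `(k₁ : π : k₂)` defines a transport plan in `Π(μ', ν')`.**
Given entropic transport kernels `k₁` for `(μ', μ)` and `k₂` for `(ν, ν')` and a plan
`π ∈ Π(μ, ν)`, the function `(x',y') ↦ ∫ k₁(x',x) k₂(y,y') dπ(x,y)` is continuous,
nonnegative, has both partial integrals equal to `1`, and the measure with this density
with respect to `μ' ⊗ ν'` is a probability measure with marginals `μ'` and `ν'`. -/
theorem smoothed_kernel_is_transport_plan
    {X : Type*} [MetricSpace X] [CompactSpace X] [MeasurableSpace X] [BorelSpace X]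
    (ε : ℝ) (hε : 0 < ε)
    (c : X → X → ℝ) (hc : Continuous fun p : X × X => c p.1 p.2)
    (μ μ' ν ν' : Measure X) [IsProbabilityMeasure μ] [IsProbabilityMeasure μ']
    [IsProbabilityMeasure ν] [IsProbabilityMeasure ν']
    (k₁ k₂ : X → X → ℝ)
    (hk₁ : IsSchrodingerKernel ε c μ' μ k₁)
    (hk₂ : IsSchrodingerKernel ε c ν ν' k₂)
    (π : Measure (X × X)) [IsProbabilityMeasure π]
    (hπ1 : π.map Prod.fst = μ) (hπ2 : π.map Prod.snd = ν)
    (t : X → X → ℝ)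
    (ht : ∀ x' y', t x' y' = ∫ p, k₁ x' p.1 * k₂ p.2 y' ∂π) :
    Continuous (fun p : X × X => t p.1 p.2) ∧
    (∀ x' y', 0 ≤ t x' y') ∧
    (∀ y, (∫ x', t x' y ∂μ') = 1) ∧
    (∀ x, (∫ y', t x y' ∂ν') = 1) ∧
    IsProbabilityMeasure
      ((μ'.prod ν').withDensity fun p => ENNReal.ofReal (t p.1 p.2)) ∧
    ((μ'.prod ν').withDensity fun p => ENNReal.ofReal (t p.1 p.2)).map Prod.fst = μ' ∧
    ((μ'.prod ν').withDensity fun p => ENNReal.ofReal (t p.1 p.2)).map Prod.snd = ν' := by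
  have hk₁c := hk₁.continuous hc
  have hk₂c := hk₂.continuous hc
  have hF : Continuous fun q : (X × X) × (X × X) => k₁ q.1.1 q.2.1 * k₂ q.2.2 q.1.2 :=
    (hk₁c.comp (by fun_prop : Continuous fun q : (X × X) × (X × X) => (q.1.1, q.2.1))).mul
      (hk₂c.comp (by fun_prop : Continuous fun q : (X × X) × (X × X) => (q.2.2, q.1.2)))
  have htc : Continuous fun p : X × X => t p.1 p.2 := by
    simp only [ht]
    exact continuous_parametric_integral_of_continuous
      (f := fun p q : X × X => k₁ p.1 q.1 * k₂ q.2 p.2) (μ := π) hF isCompact_univ |>.congr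
        fun p => by simp
  have ht0 (x' y' : X) : 0 ≤ t x' y' := by
    rw [ht]
    exact integral_nonneg fun p => mul_nonneg (hk₁.nonneg _ _) (hk₂.nonneg _ _)
  have hleft (y : X) : ∫ x', t x' y ∂μ' = 1 := by
    have hint : Integrable (fun z : X × (X × X) => k₁ z.1 z.2.1 * k₂ z.2.2 y) (μ'.prod π) :=
      (hF.comp (by fun_prop : Continuous fun z : X × (X × X) => ((z.1, y), z.2)))
        |>.integrable_of_hasCompactSupport (HasCompactSupport.of_compactSpace _)
    have hy : Continuous fun z => k₂ z y := hk₂c.comp (Continuous.prodMk_left y)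
    simp only [ht]
    rw [integral_integral_swap hint]
    simp only [integral_mul_const, hk₁.integral_left, one_mul]
    rw [← hk₂.integral_left y, ← hπ2,
      integral_map measurable_snd.aemeasurable hy.aestronglyMeasurable]
  have hright (x : X) : ∫ y', t x y' ∂ν' = 1 := by
    have hint : Integrable (fun z : X × (X × X) => k₁ x z.2.1 * k₂ z.2.2 z.1) (ν'.prod π) :=
      (hF.comp (by fun_prop : Continuous fun z : X × (X × X) => ((x, z.1), z.2)))
        |>.integrable_of_hasCompactSupport (HasCompactSupport.of_compactSpace _)
    have hx : Continuous fun z => k₁ x z := hk₁c.comp (Continuous.prodMk_right x)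
    simp only [ht]
    rw [integral_integral_swap hint]
    simp only [integral_const_mul, hk₂.integral_right, mul_one]
    rw [← hk₁.integral_right x, ← hπ1,
      integral_map measurable_fst.aemeasurable hx.aestronglyMeasurable]
  have hfst := map_fst_withDensity_prod htc ht0 μ' ν' hright
  have hsnd := map_snd_withDensity_prod htc ht0 μ' ν' hleft
  refine ⟨htc, ht0, hleft, hright, ⟨?_⟩, hfst, hsnd⟩
  rw [← Set.preimage_univ (f := Prod.fst), ← Measure.map_apply measurable_fst .univ, hfst,
    measure_univ]
end

section
/- Let (X,d) be a compact metric space, ε > 0, c : X×X → ℝ a cost satisfying Assumption (A1), μ, ν probability measures on X, and (α,β) a Schrödinger pair for (μ,ν) with entropic transport kernel k := k^ε_{μν}. Then for every x ∈ X and every y ∈ spt(ν): k(x,y) ≤ exp(2·Lip(c)) / ν(B(y,ε)), where B(y,ε) is the open ball of radius ε around y. -/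
open MeasureTheory
open scoped ENNReal

/-- The support of a measure on a metric space: points all of whose
neighbourhoods have positive measure. -/
def mSupport {X : Type*} [MetricSpace X] [MeasurableSpace X] (μ : Measure X) : Set X :=
  {x | ∀ r : ℝ, 0 < r → 0 < μ (Metric.ball x r)}

theorem integral_exp_eq_exp_neg_div_of_eq_neg_mul_log
    {X : Type*} [MeasurableSpace X] {μ : Measure X} [NeZero μ]
    {ε : ℝ} (hε : 0 < ε) {f : X → ℝ} (hf : Integrable (fun x => Real.exp (f x)) μ) {a : ℝ}
    (ha : a = -ε * Real.log (∫ x, Real.exp (f x) ∂μ)) :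
    ∫ x, Real.exp (f x) ∂μ = Real.exp (-a / ε) := by
  have h : -a / ε = Real.log (∫ x, Real.exp (f x) ∂μ) := by
    rw [ha]
    field_simp
  rw [h, Real.exp_log (integral_exp_pos hf)]

theorem le_add_of_eq_neg_mul_log_integral_exp
    {X : Type*} [MeasurableSpace X] {μ : Measure X} [NeZero μ]
    {ε : ℝ} (hε : 0 < ε) {f g : X → ℝ} (hf : Integrable (fun x => Real.exp (f x)) μ)
    (hg : Integrable (fun x => Real.exp (g x)) μ) {a b D : ℝ}
    (ha : a = -ε * Real.log (∫ x, Real.exp (f x) ∂μ))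
    (hb : b = -ε * Real.log (∫ x, Real.exp (g x) ∂μ))
    (hfg : ∀ x, g x ≤ f x + D / ε) :
    a ≤ b + D := by
  have h : Real.exp (-b / ε) ≤ Real.exp (-a / ε + D / ε) := by
    rw [Real.exp_add, ← integral_exp_eq_exp_neg_div_of_eq_neg_mul_log hε hf ha,
      ← integral_exp_eq_exp_neg_div_of_eq_neg_mul_log hε hg hb, ← integral_mul_const]
    refine integral_mono hg (hf.mul_const _) fun x => ?_
    simpa only [← Real.exp_add] using Real.exp_le_exp.2 (hfg x)
  rw [Real.exp_le_exp, ← add_div, div_le_div_iff_of_pos_right hε] at h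
  linarith

/-- **Upper bound on the entropic transport kernel.**
Under Assumption (A1) on the cost, for every `x ∈ X` and `y ∈ spt(ν)` the entropic
transport kernel satisfies `k(x,y) ≤ exp(2 Lip(c)) / ν(B(y,ε))`. -/
theorem entropic_kernel_upper_bound
    {X : Type*} [MetricSpace X] [CompactSpace X] [MeasurableSpace X] [BorelSpace X]
    (ε : ℝ) (hε : 0 < ε)
    (c : X → X → ℝ) (hc : Continuous fun p : X × X => c p.1 p.2)
    (hsym : ∀ x y, c x y = c y x) (hnn : ∀ x y, 0 ≤ c x y) (hdiag : ∀ x, c x x = 0)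
    (Lc : ℝ) (hLc : 0 < Lc)
    (hlip : ∀ x x' y, |c x y - c x' y| ≤ Lc * dist x x')
    (μ ν : Measure X) [IsProbabilityMeasure μ] [IsProbabilityMeasure ν]
    (α β : X → ℝ) (hαc : Continuous α) (hβc : Continuous β)
    (hα : ∀ x, α x = -ε * Real.log (∫ y, Real.exp ((β y - c x y) / ε) ∂ν))
    (hβ : ∀ y, β y = -ε * Real.log (∫ x, Real.exp ((α x - c x y) / ε) ∂μ))
    (k : X → X → ℝ)
    (hk : ∀ x y, k x y = Real.exp ((α x + β y - c x y) / ε)) :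
    ∀ x : X, ∀ y ∈ mSupport ν,
      k x y ≤ Real.exp (2 * Lc) / (ν (Metric.ball y ε)).toReal := by
  intro x y hy
  have hint (ρ : Measure X) [IsProbabilityMeasure ρ] {f : X → ℝ} (hf : Continuous f) :
      Integrable f ρ :=
    hf.integrable_of_hasCompactSupport (HasCompactSupport.of_compactSpace f)
  have hcl (x : X) : Continuous fun y => c x y := hc.comp (by fun_prop : Continuous fun y => (x, y))
  have hcr (y : X) : Continuous fun x => c x y := hc.comp (by fun_prop : Continuous fun x => (x, y))
  have hclip (x y y' : X) : c x y' ≤ c x y + Lc * dist y' y := by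
    have h := le_of_abs_le (hlip y' y x)
    rw [hsym y' x, hsym y x] at h
    linarith
  have hβlip (y y' : X) : β y ≤ β y' + Lc * dist y y' := by
    have hi (z : X) : Integrable (fun x => Real.exp ((α x - c x z) / ε)) μ := by
      have := hcr z
      exact hint μ (by fun_prop)
    refine le_add_of_eq_neg_mul_log_integral_exp hε (hi y) (hi y') (hβ y) (hβ y') fun x => ?_
    rw [← add_div, div_le_div_iff_of_pos_right hε]
    linarith [hclip x y' y]
  have hki : Integrable (k x) ν := by
    have := hcl x
    rw [funext (hk x)]
    exact hint ν (by fun_prop)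
  have hkone : ∫ y, k x y ∂ν = 1 := by
    have hi : Integrable (fun y => Real.exp ((β y - c x y) / ε)) ν := by
      have := hcl x
      exact hint ν (by fun_prop)
    have hsplit (z : X) : k x z = Real.exp (α x / ε) * Real.exp ((β z - c x z) / ε) := by
      rw [hk, ← Real.exp_add]
      ring_nf
    simp_rw [hsplit]
    rw [integral_const_mul, integral_exp_eq_exp_neg_div_of_eq_neg_mul_log hε hi (hα x),
      ← Real.exp_add, neg_div, add_neg_cancel, Real.exp_zero]
  have hlower : ∀ z ∈ Metric.ball y ε, k x y * Real.exp (-(2 * Lc)) ≤ k x z := by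
    intro z hz
    have hd : Lc * dist y z ≤ Lc * ε :=
      mul_le_mul_of_nonneg_left (by rw [dist_comm]; exact (Metric.mem_ball.1 hz).le) hLc.le
    have hcz := hclip x y z
    rw [dist_comm] at hcz
    rw [hk, hk, ← Real.exp_add, Real.exp_le_exp, ← sub_eq_add_neg, sub_le_iff_le_add,
      div_add' _ _ _ hε.ne', div_le_div_iff_of_pos_right hε]
    linarith [hβlip y z]
  have hpos : 0 < (ν (Metric.ball y ε)).toReal :=
    ENNReal.toReal_pos (hy ε hε).ne' (measure_ne_top _ _)
  have hball : k x y * Real.exp (-(2 * Lc)) * (ν (Metric.ball y ε)).toReal ≤ 1 := by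
    calc k x y * Real.exp (-(2 * Lc)) * (ν (Metric.ball y ε)).toReal
        ≤ ∫ z in Metric.ball y ε, k x z ∂ν :=
          setIntegral_ge_of_const_le_real measurableSet_ball (measure_ne_top _ _) hlower
            hki.integrableOn
      _ ≤ ∫ z, k x z ∂ν :=
          setIntegral_le_integral hki (Filter.Eventually.of_forall fun z => by
            rw [hk]
            exact (Real.exp_pos _).le)
      _ = 1 := hkone
  rw [le_div_iff₀ hpos]
  rw [Real.exp_neg, mul_right_comm, ← div_eq_mul_inv, div_le_one (Real.exp_pos _)] at hball
  exact hball
end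

section
/- Let (X,d) be a compact metric space, ε > 0, c : X×X → ℝ a cost satisfying Assumption (A1), μ, ν probability measures on X, and (α,β) a Schrödinger pair for (μ,ν) with entropic transport kernel k := k^ε_{μν}. Then for all x, x′ ∈ X and every y ∈ spt(ν): |k(x,y) − k(x′,y)| ≤ (2·Lip(c)·exp(2·Lip(c)) / (ε·ν(B(y,ε))))·d(x,x′), i.e. k(·,y) is Lipschitz with constant 2·Lip(c)·exp(2·Lip(c))/(ε·ν(B(y,ε))). -/
open MeasureTheory
open scoped ENNReal

/-- A continuous function on a compact space is integrable for a finite measure. -/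
lemma integrable_of_continuous_of_compactSpace
    {X : Type*} [MetricSpace X] [CompactSpace X] [MeasurableSpace X] [BorelSpace X]
    (ν : Measure X) [IsFiniteMeasure ν] {f : X → ℝ} (hf : Continuous f) : Integrable f ν :=
  hf.integrable_of_hasCompactSupport (HasCompactSupport.of_compactSpace f)

/-- A soft `c`-transform inherits the Lipschitz constant of the cost. -/
lemma softTransform_sub_le
    {X : Type*} [MetricSpace X] [CompactSpace X] [MeasurableSpace X] [BorelSpace X]
    {ε : ℝ} (hε : 0 < ε) {c : X → X → ℝ} (hc : ∀ x, Continuous (c x)) {L : ℝ}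
    (hlip : ∀ x x' y, |c x y - c x' y| ≤ L * dist x x')
    (ν : Measure X) [IsProbabilityMeasure ν] {f g : X → ℝ} (hg : Continuous g)
    (hf : ∀ x, f x = -ε * Real.log (∫ y, Real.exp ((g y - c x y) / ε) ∂ν)) (x x' : X) :
    |f x - f x'| ≤ L * dist x x' := by
  have hint : ∀ z, Integrable (fun y => Real.exp ((g y - c z y) / ε)) ν := fun z =>
    integrable_of_continuous_of_compactSpace ν
      (Real.continuous_exp.comp ((hg.sub (hc z)).div_const ε))
  have key : ∀ z z', f z' - f z ≤ L * dist z z' := by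
    intro z z'
    have hle : ∫ y, Real.exp ((g y - c z y) / ε) ∂ν ≤
        Real.exp (L * dist z z' / ε) * ∫ y, Real.exp ((g y - c z' y) / ε) ∂ν := by
      rw [← integral_const_mul]
      refine integral_mono (hint z) ((hint z').const_mul _) fun y => ?_
      dsimp only
      rw [← Real.exp_add, ← add_div]
      have := neg_le_of_abs_le (hlip z z' y)
      gcongr
      linarith
    have hlog := Real.log_le_log (integral_exp_pos (hint z)) hle
    rw [Real.log_mul (Real.exp_pos _).ne' (integral_exp_pos (hint z')).ne', Real.log_exp] at hlog
    have hmul := mul_le_mul_of_nonneg_left hlog hε.le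
    rw [mul_add, mul_div_cancel₀ _ hε.ne'] at hmul
    rw [hf z, hf z']
    linarith
  have h := key x' x
  rw [dist_comm] at h
  exact abs_le.2 ⟨by linarith [key x x'], h⟩

/-- The exponential is Lipschitz on a half line on which it is bounded. -/
lemma abs_exp_sub_exp_le {a b M : ℝ} (ha : Real.exp a ≤ M) (hb : Real.exp b ≤ M) :
    |Real.exp a - Real.exp b| ≤ M * |a - b| := by
  have key : ∀ s t : ℝ, Real.exp s ≤ M → Real.exp s - Real.exp t ≤ M * |s - t| := by
    intro s t hs
    have h1 := Real.add_one_le_exp (t - s)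
    have h2 : Real.exp t = Real.exp s * Real.exp (t - s) := by
      rw [← Real.exp_add]; congr 1; ring
    calc Real.exp s - Real.exp t = Real.exp s * (1 - Real.exp (t - s)) := by rw [h2]; ring
      _ ≤ Real.exp s * |s - t| := by
        gcongr
        linarith [le_abs_self (s - t)]
      _ ≤ M * |s - t| := by gcongr
  have h := key b a hb
  rw [abs_sub_comm] at h
  exact abs_le.2 ⟨by linarith, key a b ha⟩

/-- **Lipschitz bound on the entropic transport kernel in its first argument.**
Under Assumption (A1) on the cost, for every `y ∈ spt(ν)` the entropic transport kernel
`k(·,y)` is Lipschitz with constant `2 Lip(c) exp(2 Lip(c)) / (ε ν(B(y,ε)))`. -/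
theorem entropic_kernel_lipschitz_bound
    {X : Type*} [MetricSpace X] [CompactSpace X] [MeasurableSpace X] [BorelSpace X]
    (ε : ℝ) (hε : 0 < ε)
    (c : X → X → ℝ) (hc : Continuous fun p : X × X => c p.1 p.2)
    (hsym : ∀ x y, c x y = c y x) (hnn : ∀ x y, 0 ≤ c x y) (hdiag : ∀ x, c x x = 0)
    (Lc : ℝ) (hLc : 0 < Lc)
    (hlip : ∀ x x' y, |c x y - c x' y| ≤ Lc * dist x x')
    (μ ν : Measure X) [IsProbabilityMeasure μ] [IsProbabilityMeasure ν]
    (α β : X → ℝ) (hαc : Continuous α) (hβc : Continuous β)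
    (hα : ∀ x, α x = -ε * Real.log (∫ y, Real.exp ((β y - c x y) / ε) ∂ν))
    (hβ : ∀ y, β y = -ε * Real.log (∫ x, Real.exp ((α x - c x y) / ε) ∂μ))
    (k : X → X → ℝ)
    (hk : ∀ x y, k x y = Real.exp ((α x + β y - c x y) / ε)) :
    ∀ x x' : X, ∀ y ∈ mSupport ν,
      |k x y - k x' y| ≤
        2 * Lc * Real.exp (2 * Lc) / (ε * (ν (Metric.ball y ε)).toReal) * dist x x' := by
  intro x x' y hy
  have hcx : ∀ x, Continuous (c x) := fun x => hc.comp (Continuous.prodMk_right x)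
  have hlip' : ∀ y y' x, |c x y - c x y'| ≤ Lc * dist y y' := fun y y' x => by
    rw [hsym x y, hsym x y']
    exact hlip y y' x
  have hαlip := softTransform_sub_le hε hcx hlip ν hβc hα
  have hβlip := softTransform_sub_le (c := fun y x => c x y) hε
    (fun y => hc.comp (Continuous.prodMk_left y)) hlip' μ hαc hβ
  have hkint : ∀ z, Integrable (k z) ν := fun z => by
    rw [show k z = fun y => Real.exp ((α z + β y - c z y) / ε) from funext (hk z)]
    exact integrable_of_continuous_of_compactSpace ν
      (Real.continuous_exp.comp (((continuous_const.add hβc).sub (hcx z)).div_const ε))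
  have hkpos : ∀ z y, 0 < k z y := fun z y => hk z y ▸ Real.exp_pos _
  have hmass : ∀ z, ∫ y, k z y ∂ν = 1 := fun z => by
    have hint : Integrable (fun y => Real.exp ((β y - c z y) / ε)) ν :=
      integrable_of_continuous_of_compactSpace ν
        (Real.continuous_exp.comp ((hβc.sub (hcx z)).div_const ε))
    have hI := integral_exp_pos hint
    have hfac : ∀ y, k z y = Real.exp (α z / ε) * Real.exp ((β y - c z y) / ε) := fun y => by
      rw [hk, ← Real.exp_add]
      congr 1
      ring
    simp_rw [hfac]
    rw [integral_const_mul, hα z, neg_mul, neg_div, mul_div_cancel_left₀ _ hε.ne', Real.exp_neg,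
      Real.exp_log hI, inv_mul_cancel₀ hI.ne']
  have hball : 0 < (ν (Metric.ball y ε)).toReal :=
    ENNReal.toReal_pos (hy ε hε).ne' (measure_ne_top _ _)
  have hbound : ∀ z, k z y ≤ Real.exp (2 * Lc) / (ν (Metric.ball y ε)).toReal := by
    intro z
    rw [le_div_iff₀ hball]
    have hpt : ∀ y' ∈ Metric.ball y ε, k z y ≤ Real.exp (2 * Lc) * k z y' := by
      intro y' hy'
      rw [hk, hk, ← Real.exp_add, Real.exp_le_exp, div_le_iff₀ hε, add_mul,
        div_mul_cancel₀ _ hε.ne']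
      have hd : Lc * dist y y' ≤ Lc * ε := by
        gcongr
        rw [dist_comm]
        exact (Metric.mem_ball.1 hy').le
      linarith [le_of_abs_le (hβlip y y'), neg_le_of_abs_le (hlip' y y' z)]
    calc k z y * (ν (Metric.ball y ε)).toReal = ∫ _ in Metric.ball y ε, k z y ∂ν := by
          rw [setIntegral_const, smul_eq_mul, mul_comm, Measure.real]
      _ ≤ ∫ y' in Metric.ball y ε, Real.exp (2 * Lc) * k z y' ∂ν :=
          setIntegral_mono_on (integrable_const _).integrableOn
            ((hkint z).const_mul _).integrableOn measurableSet_ball hpt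
      _ ≤ ∫ y', Real.exp (2 * Lc) * k z y' ∂ν :=
          setIntegral_le_integral ((hkint z).const_mul _)
            (Filter.Eventually.of_forall fun y' =>
              (mul_pos (Real.exp_pos _) (hkpos z y')).le)
      _ = Real.exp (2 * Lc) := by rw [integral_const_mul, hmass, mul_one]
  have hexponent : |(α x + β y - c x y) / ε - (α x' + β y - c x' y) / ε| ≤
      2 * Lc * dist x x' / ε := by
    rw [← sub_div, abs_div, abs_of_pos hε]
    gcongr
    have h1 := abs_le.1 (hαlip x x')
    have h2 := abs_le.1 (hlip x x' y)
    exact abs_le.2 ⟨by linarith, by linarith⟩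
  have hx := hbound x
  have hx' := hbound x'
  rw [hk] at hx hx'
  rw [hk, hk]
  calc _ ≤ Real.exp (2 * Lc) / (ν (Metric.ball y ε)).toReal *
        |(α x + β y - c x y) / ε - (α x' + β y - c x' y) / ε| := abs_exp_sub_exp_le hx hx'
    _ ≤ Real.exp (2 * Lc) / (ν (Metric.ball y ε)).toReal * (2 * Lc * dist x x' / ε) := by
        gcongr
    _ = _ := by
        field_simp
end

section
/- Let (X,d) be a compact metric space, ε > 0, c : X×X → ℝ a cost satisfying Assumption (A1), μ a probability measure on X, and ᾱ a symmetric Schrödinger potential for μ with self-transport kernel k := k^ε_{μμ}. Then for every x ∈ spt(μ): exp(ᾱ(x)/ε) ≤ exp(Lip(c)) / √(μ(B(x,ε))), and consequently for all x, y ∈ spt(μ): k(x,y) ≤ exp(2·Lip(c) − c(x,y)/ε) / √(μ(B(x,ε))·μ(B(y,ε))). -/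
open MeasureTheory
open scoped ENNReal

section SchrodingerPotential

variable {X : Type*} [MetricSpace X] [CompactSpace X] [MeasurableSpace X] [BorelSpace X]
  {ε : ℝ} {c : X → X → ℝ} {μ : Measure X} [IsProbabilityMeasure μ] {α : X → ℝ} {Lc : ℝ}

lemma integrable_exp_potential (hc : Continuous fun p : X × X => c p.1 p.2) (hαc : Continuous α)
    (x : X) : Integrable (fun y => Real.exp ((α y - c x y) / ε)) μ := by
  have hcx : Continuous fun y => c x y := hc.comp (Continuous.prodMk_right x)
  have hexp : Continuous fun y => Real.exp ((α y - c x y) / ε) := by fun_prop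
  exact hexp.integrable_of_hasCompactSupport (.of_compactSpace _)

/-- The exponential form of the Schrödinger equation. -/
lemma integral_exp_potential (hε : 0 < ε) (hc : Continuous fun p : X × X => c p.1 p.2)
    (hαc : Continuous α)
    (hα : ∀ x, α x = -ε * Real.log (∫ y, Real.exp ((α y - c x y) / ε) ∂μ)) (x : X) :
    ∫ y, Real.exp ((α y - c x y) / ε) ∂μ = Real.exp (-(α x / ε)) := by
  have hpos := integral_exp_pos (integrable_exp_potential (μ := μ) (ε := ε) hc hαc x)
  rw [show -(α x / ε) = Real.log (∫ y, Real.exp ((α y - c x y) / ε) ∂μ) by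
    rw [hα x]; field_simp, Real.exp_log hpos]

/-- A Schrödinger potential inherits the Lipschitz constant of the cost. -/
lemma potential_sub_le (hε : 0 < ε) (hc : Continuous fun p : X × X => c p.1 p.2)
    (hlip : ∀ x x' y, |c x y - c x' y| ≤ Lc * dist x x') (hαc : Continuous α)
    (hα : ∀ x, α x = -ε * Real.log (∫ y, Real.exp ((α y - c x y) / ε) ∂μ)) (x y : X) :
    α x - α y ≤ Lc * dist x y := by
  have hle : Real.exp (-(α y / ε)) ≤ Real.exp (Lc * dist x y / ε + -(α x / ε)) := by
    rw [Real.exp_add, ← integral_exp_potential hε hc hαc hα x,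
      ← integral_exp_potential hε hc hαc hα y, ← integral_const_mul]
    refine integral_mono (integrable_exp_potential hc hαc y)
      ((integrable_exp_potential hc hαc x).const_mul _) fun z => ?_
    simp only [← Real.exp_add, ← add_div]
    gcongr
    linarith [le_of_abs_le (hlip x y z)]
  have h := Real.exp_le_exp.mp hle
  rw [← sub_nonneg, show Lc * dist x y / ε + -(α x / ε) - -(α y / ε)
    = (Lc * dist x y - (α x - α y)) / ε by ring] at h
  exact sub_nonneg.mp (by simpa [hε.ne'] using mul_nonneg h hε.le)

lemma exp_potential_le (hε : 0 < ε) (hc : Continuous fun p : X × X => c p.1 p.2)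
    (hdiag : ∀ x, c x x = 0) (hLc : 0 ≤ Lc)
    (hlip : ∀ x x' y, |c x y - c x' y| ≤ Lc * dist x x') (hαc : Continuous α)
    (hα : ∀ x, α x = -ε * Real.log (∫ y, Real.exp ((α y - c x y) / ε) ∂μ)) {x : X}
    (hx : x ∈ mSupport μ) :
    Real.exp (α x / ε) ≤ Real.exp Lc / Real.sqrt (μ (Metric.ball x ε)).toReal := by
  have hm : 0 < (μ (Metric.ball x ε)).toReal :=
    ENNReal.toReal_pos (hx ε hε).ne' (measure_ne_top _ _)
  have hint := integrable_exp_potential (μ := μ) (ε := ε) hc hαc x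
  have hball : (μ (Metric.ball x ε)).toReal * Real.exp (α x / ε - 2 * Lc)
      ≤ Real.exp (-(α x / ε)) := by
    rw [← integral_exp_potential hε hc hαc hα x]
    calc (μ (Metric.ball x ε)).toReal * Real.exp (α x / ε - 2 * Lc)
        = ∫ _ in Metric.ball x ε, Real.exp (α x / ε - 2 * Lc) ∂μ := by
          rw [setIntegral_const, smul_eq_mul, Measure.real]
      _ ≤ ∫ y in Metric.ball x ε, Real.exp ((α y - c x y) / ε) ∂μ := by
          refine setIntegral_mono_on (integrable_const _) hint.integrableOn
            Metric.isOpen_ball.measurableSet fun y hy => Real.exp_le_exp.mpr ?_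
          have hd : Lc * dist x y ≤ Lc * ε :=
            mul_le_mul_of_nonneg_left (Metric.mem_ball'.mp hy).le hLc
          have h₁ := potential_sub_le hε hc hlip hαc hα x y
          have h₂ := le_of_abs_le (hlip x y y)
          rw [hdiag] at h₂
          rw [le_div_iff₀ hε, sub_mul, div_mul_cancel₀ _ hε.ne']
          linarith
      _ ≤ ∫ y, Real.exp ((α y - c x y) / ε) ∂μ :=
          setIntegral_le_integral hint (.of_forall fun _ => (Real.exp_pos _).le)
  rw [le_div_iff₀ (Real.sqrt_pos.mpr hm)]
  refine (sq_le_sq₀ (by positivity) (by positivity)).mp ?_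
  rw [mul_pow, Real.sq_sqrt hm.le, ← Real.exp_nat_mul, ← Real.exp_nat_mul]
  have h := mul_le_mul_of_nonneg_right hball (Real.exp_pos (α x / ε + 2 * Lc)).le
  rw [mul_assoc, ← Real.exp_add, ← Real.exp_add] at h
  rw [mul_comm]
  convert h using 3 <;> push_cast <;> ring

end SchrodingerPotential

/-- **Improved bound for the entropic self-transport kernel.**
For a symmetric Schrödinger potential `ᾱ` of `μ`, one has
`exp(ᾱ(x)/ε) ≤ exp(Lip(c)) / √(μ(B(x,ε)))` for `x ∈ spt(μ)`, and consequently
`k(x,y) ≤ exp(2 Lip(c) - c(x,y)/ε) / √(μ(B(x,ε)) μ(B(y,ε)))` on `spt(μ) × spt(μ)`. -/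
theorem self_transport_kernel_bound
    {X : Type*} [MetricSpace X] [CompactSpace X] [MeasurableSpace X] [BorelSpace X]
    (ε : ℝ) (hε : 0 < ε)
    (c : X → X → ℝ) (hc : Continuous fun p : X × X => c p.1 p.2)
    (hsym : ∀ x y, c x y = c y x) (hnn : ∀ x y, 0 ≤ c x y) (hdiag : ∀ x, c x x = 0)
    (Lc : ℝ) (hLc : 0 < Lc)
    (hlip : ∀ x x' y, |c x y - c x' y| ≤ Lc * dist x x')
    (μ : Measure X) [IsProbabilityMeasure μ]
    (α : X → ℝ) (hαc : Continuous α)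
    (hα : ∀ x, α x = -ε * Real.log (∫ y, Real.exp ((α y - c x y) / ε) ∂μ))
    (k : X → X → ℝ)
    (hk : ∀ x y, k x y = Real.exp ((α x + α y - c x y) / ε)) :
    (∀ x ∈ mSupport μ,
      Real.exp (α x / ε) ≤ Real.exp Lc / Real.sqrt (μ (Metric.ball x ε)).toReal) ∧
    (∀ x ∈ mSupport μ, ∀ y ∈ mSupport μ,
      k x y ≤ Real.exp (2 * Lc - c x y / ε) /
        Real.sqrt ((μ (Metric.ball x ε)).toReal * (μ (Metric.ball y ε)).toReal)) := by
  have key : ∀ x ∈ mSupport μ,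
      Real.exp (α x / ε) ≤ Real.exp Lc / Real.sqrt (μ (Metric.ball x ε)).toReal :=
    fun x hx => exp_potential_le hε hc hdiag hLc.le hlip hαc hα hx
  refine ⟨key, fun x hx y hy => ?_⟩
  calc k x y = Real.exp (α x / ε) * Real.exp (α y / ε) * Real.exp (-(c x y / ε)) := by
        rw [hk, ← Real.exp_add, ← Real.exp_add]
        congr 1
        ring
    _ ≤ Real.exp Lc / Real.sqrt (μ (Metric.ball x ε)).toReal *
          (Real.exp Lc / Real.sqrt (μ (Metric.ball y ε)).toReal) * Real.exp (-(c x y / ε)) := by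
        gcongr
        exacts [key x hx, key y hy]
    _ = _ := by
        rw [Real.sqrt_mul ENNReal.toReal_nonneg, div_mul_div_comm, div_mul_eq_mul_div,
          ← Real.exp_add, ← Real.exp_add]
        ring_nf
end

section
/- Let (X,d) be a compact metric space, μ, μ′, ν, ν′ probability measures on X, γ^μ ∈ Π(μ,μ′) and γ^ν ∈ Π(ν,ν′) couplings, with disintegrations (γ^μ(·|x))_x and (γ^ν(·|y))_y with respect to their first marginals. Let t : X×X → ℝ satisfy |t(x′,y′) − t(x,y)| ≤ L·√(d(x,x′)² + d(y,y′)²) for all x,x′,y,y′ ∈ X and some L > 0, and define t^A(x,y) := ∫∫ t(x′,y′) dγ^μ(x′|x) dγ^ν(y′|y). Then ‖t^A − t‖_{L²(μ⊗ν)} ≤ L·√( ∫ d(x,x′)² dγ^μ(x,x′) + ∫ d(y,y′)² dγ^ν(y,y′) ). In particular, if γ^μ and γ^ν are optimal couplings for the quadratic cost d², then ‖t^A − t‖_{L²(μ⊗ν)} ≤ L·√( W₂(μ,μ′)² + W₂(ν,ν′)² ). -/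
open MeasureTheory ProbabilityTheory
open scoped ENNReal

/-- The squared 2-Wasserstein distance between two probability measures on a
metric space, defined as the infimal transport cost for the quadratic cost. -/
noncomputable def W2sq {X : Type*} [MetricSpace X] [MeasurableSpace X]
    (μ ν : Measure X) : ℝ :=
  sInf {r : ℝ | ∃ γ : Measure (X × X), IsProbabilityMeasure γ ∧
    γ.map Prod.fst = μ ∧ γ.map Prod.snd = ν ∧ r = ∫ p, dist p.1 p.2 ^ 2 ∂γ}

lemma sq_integral_le_integral_sq {Ω : Type*} [MeasurableSpace Ω] {P : Measure Ω}
    [IsProbabilityMeasure P] {f : Ω → ℝ} (hf : MemLp f 2 P) :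
    (∫ x, f x ∂P) ^ 2 ≤ ∫ x, f x ^ 2 ∂P := by
  have h := variance_nonneg f P
  rw [variance_eq_sub hf] at h
  simpa using h

lemma integrable_dist_sq {X : Type*} [MetricSpace X] [CompactSpace X] [MeasurableSpace X]
    [BorelSpace X] (γ : Measure (X × X)) [IsFiniteMeasure γ] :
    Integrable (fun p : X × X => dist p.1 p.2 ^ 2) γ := by
  have hc : Continuous fun p : X × X => dist p.1 p.2 ^ 2 := by fun_prop
  exact hc.integrable_of_hasCompactSupport (HasCompactSupport.of_compactSpace _)

lemma integrable_dist_sq_left {X : Type*} [MetricSpace X] [CompactSpace X] [MeasurableSpace X]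
    [BorelSpace X] (P : Measure X) [IsFiniteMeasure P] (x : X) :
    Integrable (fun x' => dist x x' ^ 2) P := by
  have hc : Continuous fun x' => dist x x' ^ 2 := by fun_prop
  exact hc.integrable_of_hasCompactSupport (HasCompactSupport.of_compactSpace _)

/-- A kernel that is Lipschitz for the 2-product metric moves, when averaged over `P ⊗ Q`, by at
most the quadratic transport costs of `P` and `Q` from Dirac masses. -/
lemma sq_integral_integral_sub_le {X : Type*} [MetricSpace X] [CompactSpace X]
    [MeasurableSpace X] [BorelSpace X] (P Q : Measure X) [IsProbabilityMeasure P]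
    [IsProbabilityMeasure Q] {t : X → X → ℝ} (hmeas : Measurable fun p : X × X => t p.1 p.2)
    {L : ℝ} (x y : X)
    (hlip : ∀ x' y', |t x' y' - t x y| ≤ L * √(dist x x' ^ 2 + dist y y' ^ 2)) :
    ((∫ x', ∫ y', t x' y' ∂Q ∂P) - t x y) ^ 2 ≤
      L ^ 2 * ((∫ x', dist x x' ^ 2 ∂P) + ∫ y', dist y y' ^ 2 ∂Q) := by
  have hint : Integrable (fun p : X × X => L ^ 2 * (dist x p.1 ^ 2 + dist y p.2 ^ 2))
      (P.prod Q) :=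
    (((integrable_dist_sq_left P x).comp_fst Q).add
      ((integrable_dist_sq_left Q y).comp_snd P)).const_mul _
  have hle : ∀ p : X × X,
      (t p.1 p.2 - t x y) ^ 2 ≤ L ^ 2 * (dist x p.1 ^ 2 + dist y p.2 ^ 2) := fun p => by
    have h := pow_le_pow_left₀ (abs_nonneg _) (hlip p.1 p.2) 2
    rwa [sq_abs, mul_pow, Real.sq_sqrt (by positivity)] at h
  have hsub : Measurable fun p : X × X => t p.1 p.2 - t x y := hmeas.sub_const _
  have hsq : Integrable (fun p : X × X => (t p.1 p.2 - t x y) ^ 2) (P.prod Q) :=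
    hint.mono' (hsub.pow_const 2).aestronglyMeasurable
      (.of_forall fun p => by simpa using hle p)
  have hLp : MemLp (fun p : X × X => t p.1 p.2 - t x y) 2 (P.prod Q) :=
    (memLp_two_iff_integrable_sq hsub.aestronglyMeasurable).2 hsq
  have ht : Integrable (fun p : X × X => t p.1 p.2) (P.prod Q) := by
    simpa using (integrable_add_const_iff (c := -t x y)).1 (hLp.integrable one_le_two)
  have heq : (∫ x', ∫ y', t x' y' ∂Q ∂P) - t x y =
      ∫ p, (t p.1 p.2 - t x y) ∂(P.prod Q) := by
    rw [integral_sub ht (integrable_const _), integral_prod _ ht]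
    simp
  calc _ = (∫ p, (t p.1 p.2 - t x y) ∂(P.prod Q)) ^ 2 := by rw [heq]
    _ ≤ ∫ p, (t p.1 p.2 - t x y) ^ 2 ∂(P.prod Q) := sq_integral_le_integral_sq hLp
    _ ≤ ∫ p, L ^ 2 * (dist x p.1 ^ 2 + dist y p.2 ^ 2) ∂(P.prod Q) :=
      integral_mono hsq hint hle
    _ = _ := by
      rw [integral_const_mul, integral_add ((integrable_dist_sq_left P x).comp_fst Q)
        ((integrable_dist_sq_left Q y).comp_snd P),
        integral_fun_fst (fun x' => dist x x' ^ 2), integral_fun_snd (fun y' => dist y y' ^ 2)]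
      simp

lemma eLpNorm_two_le_of_sq_le {Ω : Type*} [MeasurableSpace Ω] {P : Measure Ω} {f g : Ω → ℝ}
    (hg : Integrable g P) (hfg : ∀ x, f x ^ 2 ≤ g x) :
    eLpNorm f 2 P ≤ ENNReal.ofReal √(∫ x, g x ∂P) := by
  have hg0 : 0 ≤ g := fun x => (sq_nonneg _).trans (hfg x)
  rw [eLpNorm_eq_lintegral_rpow_enorm_toReal two_ne_zero ENNReal.ofNat_ne_top,
    Real.sqrt_eq_rpow, ← ENNReal.ofReal_rpow_of_nonneg (integral_nonneg hg0) (by norm_num),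
    ofReal_integral_eq_lintegral_ofReal hg (.of_forall hg0)]
  simp only [ENNReal.toReal_ofNat, ENNReal.rpow_ofNat]
  gcongr with x
  rw [Real.enorm_eq_ofReal_abs, ← ENNReal.ofReal_pow (abs_nonneg _), sq_abs]
  exact ENNReal.ofReal_le_ofReal (hfg x)

/-- **Piecewise-averaging error bound (Theorem on `T^{A,ε}_N` vs `T^{B,ε}_N`).**
If `t` is `L`-Lipschitz for the 2-product metric and `t^A` is obtained by averaging `t`
over the conditional distributions of couplings `γ^μ ∈ Π(μ,μ')`, `γ^ν ∈ Π(ν,ν')`, then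
`‖t^A - t‖_{L²(μ⊗ν)} ≤ L √(∫ d² dγ^μ + ∫ d² dγ^ν)`; in particular, for optimal
couplings, `‖t^A - t‖_{L²(μ⊗ν)} ≤ L √(W₂²(μ,μ') + W₂²(ν,ν'))`. -/
theorem averaged_kernel_L2_error
    {X : Type*} [MetricSpace X] [CompactSpace X] [MeasurableSpace X] [BorelSpace X]
    (μ μ' ν ν' : Measure X) [IsProbabilityMeasure μ] [IsProbabilityMeasure μ']
    [IsProbabilityMeasure ν] [IsProbabilityMeasure ν']
    (γμ γν : Measure (X × X)) [IsProbabilityMeasure γμ] [IsProbabilityMeasure γν]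
    (hγμ1 : γμ.map Prod.fst = μ) (hγμ2 : γμ.map Prod.snd = μ')
    (hγν1 : γν.map Prod.fst = ν) (hγν2 : γν.map Prod.snd = ν')
    (κμ κν : Kernel X X) [IsMarkovKernel κμ] [IsMarkovKernel κν]
    (hdμ : γμ = μ.compProd κμ) (hdν : γν = ν.compProd κν)
    (t : X → X → ℝ) (hmeas : Measurable fun p : X × X => t p.1 p.2)
    (L : ℝ) (hL : 0 < L)
    (hlip : ∀ x x' y y' : X,
      |t x' y' - t x y| ≤ L * Real.sqrt (dist x x' ^ 2 + dist y y' ^ 2))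
    (tA : X → X → ℝ)
    (htA : ∀ x y, tA x y = ∫ x', ∫ y', t x' y' ∂(κν y) ∂(κμ x)) :
    eLpNorm (fun p : X × X => tA p.1 p.2 - t p.1 p.2) 2 (μ.prod ν)
      ≤ ENNReal.ofReal (L * Real.sqrt
          ((∫ p, dist p.1 p.2 ^ 2 ∂γμ) + ∫ p, dist p.1 p.2 ^ 2 ∂γν)) ∧
    ((∫ p, dist p.1 p.2 ^ 2 ∂γμ) = W2sq μ μ' →
     (∫ p, dist p.1 p.2 ^ 2 ∂γν) = W2sq ν ν' →
      eLpNorm (fun p : X × X => tA p.1 p.2 - t p.1 p.2) 2 (μ.prod ν)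
        ≤ ENNReal.ofReal (L * Real.sqrt (W2sq μ μ' + W2sq ν ν'))) := by
  have hbound : eLpNorm (fun p : X × X => tA p.1 p.2 - t p.1 p.2) 2 (μ.prod ν)
      ≤ ENNReal.ofReal (L * Real.sqrt
          ((∫ p, dist p.1 p.2 ^ 2 ∂γμ) + ∫ p, dist p.1 p.2 ^ 2 ∂γν)) := by
    have hμ := integrable_dist_sq (μ.compProd κμ)
    have hν := integrable_dist_sq (ν.compProd κν)
    have ha : Integrable (fun p : X × X => ∫ x', dist p.1 x' ^ 2 ∂κμ p.1) (μ.prod ν) :=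
      (Integrable.integral_compProd hμ).comp_fst ν
    have hb : Integrable (fun p : X × X => ∫ y', dist p.2 y' ^ 2 ∂κν p.2) (μ.prod ν) :=
      (Integrable.integral_compProd hν).comp_snd μ
    have h := eLpNorm_two_le_of_sq_le (f := fun p : X × X => tA p.1 p.2 - t p.1 p.2)
      ((ha.add hb).const_mul (L ^ 2)) fun p => by
        rw [htA]
        exact sq_integral_integral_sub_le _ _ hmeas p.1 p.2
          fun x' y' => hlip p.1 x' p.2 y'
    rw [integral_const_mul, integral_add' ha hb,
      integral_fun_fst (fun x => ∫ x', dist x x' ^ 2 ∂κμ x),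
      integral_fun_snd (fun y => ∫ y', dist y y' ^ 2 ∂κν y),
      Real.sqrt_mul (sq_nonneg L), Real.sqrt_sq hL.le] at h
    rw [hdμ, hdν, Measure.integral_compProd hμ, Measure.integral_compProd hν]
    simpa using h
  exact ⟨hbound, fun h₁ h₂ => h₁ ▸ h₂ ▸ hbound⟩
end

section
/- Let (X,d) be a compact metric space, ε > 0, c : X×X → ℝ continuous, and let μ and μ̂ be probability measures on X. Let ᾱ be a symmetric Schrödinger potential for μ with self-transport kernel k, and ᾱ̂ a symmetric Schrödinger potential for μ̂ with self-transport kernel k̂ (both with cost c and parameter ε). Let σ ∈ ℝ and for x′ ∈ X define Q(x′) := (4/ε)·sup_{x∈X} |ᾱ̂(x) + σ − ᾱ(x)| + |log( ∫ k(x,x′) dμ̂(x) )|. Then for every x′ ∈ X with Q(x′) ≤ 1 one has sup_{x∈X} |k̂(x,x′) − k(x,x′)| ≤ 2·( sup_{x∈X} k(x,x′) )·Q(x′). -/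
open MeasureTheory
open scoped ENNReal

/-- A symmetric Schrödinger potential for `μ` with cost `c` and regularization `ε`. -/
def IsSymSchrodingerPotential {X : Type*} [MetricSpace X] [MeasurableSpace X]
    (ε : ℝ) (c : X → X → ℝ) (μ : Measure X) (α : X → ℝ) : Prop :=
  Continuous α ∧ ∀ x, α x = -ε * Real.log (∫ y, Real.exp ((α y - c x y) / ε) ∂μ)

/-- If `f * exp (t + s)` has integral one and `|t| ≤ δ`, then `log ∫ f` is within `δ` of `-s`. -/
theorem abs_add_log_integral_le {X : Type*} [MeasurableSpace X] {μ : Measure X}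
    {f g t : X → ℝ} {s δ : ℝ} (hf : Integrable f μ) (hg : Integrable g μ)
    (hf0 : ∀ x, 0 ≤ f x) (hgf : ∀ x, g x = f x * Real.exp (t x + s)) (ht : ∀ x, |t x| ≤ δ)
    (hg1 : ∫ x, g x ∂μ = 1) :
    |s + Real.log (∫ x, f x ∂μ)| ≤ δ := by
  have hupper : 1 ≤ (∫ x, f x ∂μ) * Real.exp (δ + s) := by
    rw [← hg1, ← integral_mul_const]
    refine integral_mono hg (hf.mul_const _) fun x => ?_
    simp only [hgf]
    exact mul_le_mul_of_nonneg_left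
      (Real.exp_le_exp.mpr (by linarith [(abs_le.mp (ht x)).2])) (hf0 x)
  have hlower : (∫ x, f x ∂μ) * Real.exp (-δ + s) ≤ 1 := by
    rw [← hg1, ← integral_mul_const]
    refine integral_mono (hf.mul_const _) hg fun x => ?_
    simp only [hgf]
    exact mul_le_mul_of_nonneg_left
      (Real.exp_le_exp.mpr (by linarith [(abs_le.mp (ht x)).1])) (hf0 x)
  have hpos : 0 < ∫ x, f x ∂μ :=
    pos_of_mul_pos_left (one_pos.trans_le hupper) (Real.exp_pos _).le
  have hlog_upper := Real.log_le_log one_pos hupper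
  have hlog_lower := Real.log_le_log (mul_pos hpos (Real.exp_pos _)) hlower
  rw [Real.log_mul hpos.ne' (Real.exp_pos _).ne', Real.log_exp, Real.log_one] at hlog_upper
  rw [Real.log_mul hpos.ne' (Real.exp_pos _).ne', Real.log_exp, Real.log_one] at hlog_lower
  exact abs_le.mpr ⟨by linarith, by linarith⟩

/-- **Stability of the entropic self-transport kernel under perturbation of the
potential.**  If `ᾱ` and `ᾱ̂` are symmetric Schrödinger potentials for `μ` and `μ̂` with
self-transport kernels `k` and `k̂`, and
`Q(x') = (4/ε) sup_x |ᾱ̂(x) + σ - ᾱ(x)| + |log ∫ k(x,x') dμ̂(x)| ≤ 1`, then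
`sup_x |k̂(x,x') - k(x,x')| ≤ 2 (sup_x k(x,x')) Q(x')`. -/
theorem self_transport_kernel_stability
    {X : Type*} [MetricSpace X] [CompactSpace X] [MeasurableSpace X] [BorelSpace X]
    (ε : ℝ) (hε : 0 < ε)
    (c : X → X → ℝ) (hc : Continuous fun p : X × X => c p.1 p.2)
    (μ μh : Measure X) [IsProbabilityMeasure μ] [IsProbabilityMeasure μh]
    (α αh : X → ℝ)
    (hα : IsSymSchrodingerPotential ε c μ α)
    (hαh : IsSymSchrodingerPotential ε c μh αh)
    (k kh : X → X → ℝ)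
    (hk : ∀ x y, k x y = Real.exp ((α x + α y - c x y) / ε))
    (hkh : ∀ x y, kh x y = Real.exp ((αh x + αh y - c x y) / ε))
    (hknorm : ∀ y, ∫ x, k x y ∂μ = 1)
    (hkhnorm : ∀ y, ∫ x, kh x y ∂μh = 1)
    (σ : ℝ) (Q : X → ℝ)
    (hQ : ∀ x', Q x' = (4 / ε) * (⨆ x : X, |αh x + σ - α x|)
        + |Real.log (∫ x, k x x' ∂μh)|) :
    ∀ x' : X, Q x' ≤ 1 →
      ∀ x : X, |kh x x' - k x x'| ≤ 2 * (⨆ x'' : X, k x'' x') * Q x' := by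
  intro x' hQ1 x
  obtain ⟨hαc, -⟩ := hα
  obtain ⟨hαhc, -⟩ := hαh
  have hcx : Continuous fun y => c y x' := hc.comp (by fun_prop : Continuous fun y => (y, x'))
  have hkc : Continuous fun y => k y x' := by
    simp only [hk]
    fun_prop
  have hkhc : Continuous fun y => kh y x' := by
    simp only [hkh]
    fun_prop
  set D := ⨆ y : X, |αh y + σ - α y|
  have hle : ∀ y, |αh y + σ - α y| / ε ≤ D / ε := fun y => by
    have hbdd : BddAbove (Set.range fun y : X => |αh y + σ - α y|) :=
      (isCompact_range (by fun_prop)).bddAbove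
    gcongr
    exact le_ciSup hbdd y
  have hratio : ∀ y, kh y x' = k y x' *
      Real.exp ((αh y + σ - α y) / ε + ((αh x' + σ - α x') / ε - 2 * σ / ε)) := fun y => by
    rw [hk, hkh, ← Real.exp_add]
    congr 1
    ring
  have hbound : ∀ y, |(αh y + σ - α y) / ε| ≤ D / ε := fun y => by
    rw [abs_div, abs_of_pos hε]
    exact hle y
  have hkpos : ∀ y, 0 < k y x' := fun y => by
    rw [hk]
    exact Real.exp_pos _
  have hlog := abs_add_log_integral_le
    (hkc.integrable_of_hasCompactSupport (HasCompactSupport.of_compactSpace _))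
    (hkhc.integrable_of_hasCompactSupport (HasCompactSupport.of_compactSpace _))
    (fun y => (hkpos y).le) hratio hbound (hkhnorm x')
  have hexp : |(αh x + σ - α x) / ε + ((αh x' + σ - α x') / ε - 2 * σ / ε)| ≤ Q x' := by
    have h4 : 4 / ε * D = 4 * (D / ε) := by ring
    rw [hQ x', h4]
    have hx := abs_le.mp (hbound x)
    have hl := abs_le.mp hlog
    have hI₁ := le_abs_self (Real.log (∫ y, k y x' ∂μh))
    have hI₂ := neg_abs_le (Real.log (∫ y, k y x' ∂μh))
    exact abs_le.mpr ⟨by linarith [hx.1, hl.1], by linarith [hx.2, hl.2]⟩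
  have hsup : k x x' ≤ ⨆ y : X, k y x' := le_ciSup (isCompact_range hkc).bddAbove x
  rw [hratio x, ← mul_sub_one, abs_mul, abs_of_pos (hkpos x)]
  calc k x x' * |Real.exp _ - 1|
      ≤ k x x' * (2 * |(αh x + σ - α x) / ε + ((αh x' + σ - α x') / ε - 2 * σ / ε)|) :=
        mul_le_mul_of_nonneg_left (Real.abs_exp_sub_one_le (hexp.trans hQ1)) (hkpos x).le
    _ ≤ (⨆ y : X, k y x') * (2 * Q x') :=
        mul_le_mul hsup (by linarith) (by positivity) ((hkpos x).le.trans hsup)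
    _ = 2 * (⨆ y : X, k y x') * Q x' := by ring
end

section
/- Let (X,d) be a compact metric space, c : X×X → ℝ a cost satisfying Assumption (A1), and μ, ν probability measures on X satisfying Assumption (A2) with constants (C_μ, D_μ, δ_μ) and (C_ν, D_ν, δ_ν). Let t : X×X → ℝ be bounded and measurable with |t(x′,y′) − t(x,y)| ≤ L·(c(x,x′) + c(y,y′))^l for all x,x′,y,y′ ∈ X and constants L, l > 0. For ε > 0 let ᾱ_μ, ᾱ_ν be symmetric Schrödinger potentials for μ and ν (cost c, parameter ε) with self-transport kernels k^ε_{μμ}, k^ε_{νν}, and define t^ε(x,y) := ∫∫ t(x′,y′)·k^ε_{μμ}(x,x′)·k^ε_{νν}(y,y′) dμ(x′) dν(y′). Then there exist constants C > 0 and ε₀ ∈ (0, e^{−1}], depending only on L, l, sup|t|, Lip(c) and the constants in Assumption (A2) for μ and ν, such that for every ε ∈ (0, ε₀], every x ∈ spt(μ) and every y ∈ spt(ν): |t^ε(x,y) − t(x,y)| ≤ C·(ε·log(1/ε))^l; consequently also ‖t^ε − t‖_{L²(μ⊗ν)} ≤ C·(ε·log(1/ε))^l. -/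
open MeasureTheory
open scoped ENNReal

theorem Continuous.integrable_of_compactSpace {Y : Type*} [TopologicalSpace Y] [CompactSpace Y]
    [MeasurableSpace Y] [OpensMeasurableSpace Y] {ρ : Measure Y} [IsFiniteMeasure ρ]
    {f : Y → ℝ} (hf : Continuous f) : Integrable f ρ :=
  hf.integrable_of_hasCompactSupport (HasCompactSupport.of_compactSpace f)

theorem mSupport_mem_ae {X : Type*} [MetricSpace X] [CompactSpace X] [MeasurableSpace X]
    (μ : Measure X) : ∀ᵐ x ∂μ, x ∈ mSupport μ := by
  filter_upwards [Measure.support_mem_ae (μ := μ)] with x hx r hr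
  exact (Metric.nhds_basis_ball.mem_measureSupport.1 hx) r hr

section Potential

variable {X : Type*} [MetricSpace X] [CompactSpace X] [MeasurableSpace X] [BorelSpace X]
  {c : X → X → ℝ} {μ : Measure X} [IsProbabilityMeasure μ] {ε Lc : ℝ} {α : X → ℝ}

/-- A Schrödinger potential inherits the Lipschitz bound of the cost. -/
theorem IsSymSchrodingerPotential.sub_le (hα : IsSymSchrodingerPotential ε c μ α) (hε : 0 < ε)
    (hc : Continuous (fun p : X × X => c p.1 p.2))
    (hLip : ∀ x x' y, |c x y - c x' y| ≤ Lc * dist x x') (x x' : X) :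
    α x - Lc * dist x x' ≤ α x' := by
  have hcont := hα.1
  have hint : ∀ z, Integrable (fun y => Real.exp ((α y - c z y) / ε)) μ := fun z =>
    Continuous.integrable_of_compactSpace (by
      have : Continuous (fun y => c z y) := hc.comp (Continuous.prodMk_right z)
      fun_prop)
  have hpos : ∀ z, 0 < ∫ y, Real.exp ((α y - c z y) / ε) ∂μ := fun z => integral_exp_pos (hint z)
  have hle : ∫ y, Real.exp ((α y - c x' y) / ε) ∂μ
      ≤ Real.exp (Lc * dist x x' / ε) * ∫ y, Real.exp ((α y - c x y) / ε) ∂μ := by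
    rw [← integral_const_mul]
    refine integral_mono (hint x') ((hint x).const_mul _) fun y => ?_
    simp only
    rw [← Real.exp_add, ← add_div]
    gcongr
    linarith [(abs_le.1 (hLip x x' y)).2]
  have hlog := Real.log_le_log (hpos x') hle
  rw [Real.log_mul (Real.exp_pos _).ne' (hpos x).ne', Real.log_exp] at hlog
  have h := mul_le_mul_of_nonneg_left hlog hε.le
  rw [mul_add, mul_div_cancel₀ _ hε.ne'] at h
  linarith [hα.2 x, hα.2 x']

/-- Upper bound on the potential on the support of a measure with a lower mass bound. -/
theorem IsSymSchrodingerPotential.exp_two_mul_le (hα : IsSymSchrodingerPotential ε c μ α)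
    (hε : 0 < ε) (hLc : 0 < Lc) (hc : Continuous (fun p : X × X => c p.1 p.2))
    (hc0 : ∀ x, c x x = 0) (hLip : ∀ x x' y, |c x y - c x' y| ≤ Lc * dist x x')
    (hk : ∀ y, ∫ x, Real.exp ((α x + α y - c x y) / ε) ∂μ = 1)
    {C D : ℝ} (hC : 0 < C) {x : X}
    (hball : ENNReal.ofReal (C * ε ^ D) ≤ μ (Metric.ball x ε)) :
    Real.exp (2 * α x / ε) ≤ Real.exp (2 * Lc) / C * ε ^ (-D) := by
  have hcont := hα.1
  have hint : Integrable (fun x' => Real.exp ((α x' + α x - c x' x) / ε)) μ :=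
    Continuous.integrable_of_compactSpace (by
      have : Continuous (fun y => c y x) := hc.comp (Continuous.prodMk_left x)
      fun_prop)
  have hmass : C * ε ^ D ≤ μ.real (Metric.ball x ε) :=
    (ENNReal.ofReal_le_iff_le_toReal (measure_ne_top _ _)).1 hball
  have hge : μ.real (Metric.ball x ε) • Real.exp (2 * α x / ε - 2 * Lc)
      ≤ ∫ x' in Metric.ball x ε, Real.exp ((α x' + α x - c x' x) / ε) ∂μ := by
    refine setIntegral_ge_of_const_le measurableSet_ball (measure_ne_top _ _) (fun x' hx' => ?_)
      hint.integrableOn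
    have hd : dist x' x < ε := hx'
    have h1 := hα.sub_le hε hc hLip x x'
    have h2 := (abs_le.1 (hLip x' x x)).2
    rw [hc0] at h2
    rw [dist_comm] at h1
    have h3 : Lc * dist x' x ≤ Lc * ε := by gcongr
    rw [Real.exp_le_exp, le_div_iff₀ hε, sub_mul, div_mul_cancel₀ _ hε.ne']
    linarith
  have hone : C * ε ^ D * Real.exp (2 * α x / ε - 2 * Lc) ≤ 1 := by
    calc C * ε ^ D * Real.exp (2 * α x / ε - 2 * Lc)
        ≤ μ.real (Metric.ball x ε) * Real.exp (2 * α x / ε - 2 * Lc) := by gcongr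
      _ ≤ _ := hge
      _ ≤ _ := setIntegral_le_integral hint (ae_of_all _ fun _ => (Real.exp_pos _).le)
      _ = 1 := hk x
  have hεD : 0 < ε ^ D := Real.rpow_pos_of_pos hε D
  rw [Real.exp_sub] at hone
  rw [Real.rpow_neg hε.le]
  have hE := Real.exp_pos (2 * Lc)
  field_simp at hone ⊢
  linarith

/-- Off the region `c ≤ K ε log (1/ε)` the self-transport kernel is `O(ε ^ l)`. -/
theorem IsSymSchrodingerPotential.kernel_tail_le (hα : IsSymSchrodingerPotential ε c μ α)
    (hε : 0 < ε) (hε1 : ε ≤ 1) (hLc : 0 < Lc) (hc : Continuous (fun p : X × X => c p.1 p.2))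
    (hc0 : ∀ x, c x x = 0) (hLip : ∀ x x' y, |c x y - c x' y| ≤ Lc * dist x x')
    (hk : ∀ y, ∫ x, Real.exp ((α x + α y - c x y) / ε) ∂μ = 1)
    {C D l K : ℝ} (hC : 0 < C) (hK : D + l ≤ K) {x x' : X}
    (hx : ENNReal.ofReal (C * ε ^ D) ≤ μ (Metric.ball x ε))
    (hx' : ENNReal.ofReal (C * ε ^ D) ≤ μ (Metric.ball x' ε))
    (hfar : K * (ε * Real.log (1 / ε)) < c x x') :
    Real.exp ((α x + α x' - c x x') / ε) ≤ Real.exp (2 * Lc) / C * ε ^ l := by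
  have h1 := hα.exp_two_mul_le hε hLc hc hc0 hLip hk hC hx
  have h2 := hα.exp_two_mul_le hε hLc hc hc0 hLip hk hC hx'
  have hprod : Real.exp ((α x + α x') / ε) ≤ Real.exp (2 * Lc) / C * ε ^ (-D) := by
    rw [add_div, Real.exp_add]
    have e : ∀ z, Real.exp (2 * α z / ε) = Real.exp (α z / ε) ^ 2 := fun z => by
      rw [← Real.exp_nat_mul]; congr 1; push_cast; ring
    rw [e] at h1 h2
    nlinarith [sq_nonneg (Real.exp (α x / ε) - Real.exp (α x' / ε))]
  have hcost : Real.exp (-(c x x') / ε) ≤ ε ^ K := by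
    rw [Real.rpow_def_of_pos hε, Real.exp_le_exp, div_le_iff₀ hε]
    rw [one_div, Real.log_inv] at hfar
    linarith
  calc Real.exp ((α x + α x' - c x x') / ε)
      = Real.exp ((α x + α x') / ε) * Real.exp (-(c x x') / ε) := by
        rw [← Real.exp_add]; congr 1; ring
    _ ≤ (Real.exp (2 * Lc) / C * ε ^ (-D)) * ε ^ K := by gcongr
    _ = Real.exp (2 * Lc) / C * ε ^ (-D + K) := by rw [Real.rpow_add hε]; ring
    _ ≤ Real.exp (2 * Lc) / C * ε ^ l := by
        gcongr ?_ * ?_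
        exact Real.rpow_le_rpow_of_exponent_ge hε hε1 (by linarith)

end Potential

/-- If `|t - s|` is small where the costs `a`, `b` are at most `R`, and the densities `f`, `g` are
small elsewhere, then averaging `t` against `f ⊗ g` changes it little from the constant `s`. -/
theorem abs_integral_mul_mul_sub_le {X Y : Type*} [MeasurableSpace X] [MeasurableSpace Y]
    {μ : Measure X} {ν : Measure Y} [IsProbabilityMeasure μ] [IsProbabilityMeasure ν]
    {t : X × Y → ℝ} {f a : X → ℝ} {g b : Y → ℝ} {s L l M R A B : ℝ}
    (hL : 0 ≤ L) (hl : 0 < l) (hM : 0 ≤ M) (hA : 0 ≤ A) (hB : 0 ≤ B) (hR : 0 ≤ R)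
    (ha : ∀ x, 0 ≤ a x) (hb : ∀ y, 0 ≤ b y) (hf : ∀ x, 0 ≤ f x) (hg : ∀ y, 0 ≤ g y)
    (hfi : Integrable f μ) (hgi : Integrable g ν) (hf1 : ∫ x, f x ∂μ = 1)
    (hg1 : ∫ y, g y ∂ν = 1)
    (hti : Integrable (fun p : X × Y => t p * (f p.1 * g p.2)) (μ.prod ν))
    (htM : ∀ p, |t p - s| ≤ M) (htL : ∀ p, |t p - s| ≤ L * (a p.1 + b p.2) ^ l)
    (hfA : ∀ᵐ x ∂μ, R < a x → f x ≤ A) (hgB : ∀ᵐ y ∂ν, R < b y → g y ≤ B) :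
    |(∫ p, t p * (f p.1 * g p.2) ∂μ.prod ν) - s| ≤ L * (2 * R) ^ l + M * A + M * B := by
  have hfg : Integrable (fun p : X × Y => f p.1 * g p.2) (μ.prod ν) := hfi.mul_prod hgi
  have hfg1 : ∫ p : X × Y, f p.1 * g p.2 ∂μ.prod ν = 1 := by
    rw [integral_prod_mul, hf1, hg1, one_mul]
  have hf' : Integrable (fun p : X × Y => f p.1) (μ.prod ν) := hfi.comp_fst ν
  have hg' : Integrable (fun p : X × Y => g p.2) (μ.prod ν) := hgi.comp_snd μ
  have hf1' : ∫ p : X × Y, f p.1 ∂μ.prod ν = 1 := by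
    simpa [hf1] using integral_prod_mul (μ := μ) (ν := ν) f (fun _ => (1 : ℝ))
  have hg1' : ∫ p : X × Y, g p.2 ∂μ.prod ν = 1 := by
    simpa [hg1] using integral_prod_mul (μ := μ) (ν := ν) (fun _ => (1 : ℝ)) g
  have hdiff : (∫ p, t p * (f p.1 * g p.2) ∂μ.prod ν) - s
      = ∫ p, (t p - s) * (f p.1 * g p.2) ∂μ.prod ν := by
    simp only [sub_mul]
    rw [integral_sub hti (hfg.const_mul s), integral_const_mul, hfg1, mul_one]
  have hsum : Integrable (fun p : X × Y => L * (2 * R) ^ l * (f p.1 * g p.2) + M * A * g p.2)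
      (μ.prod ν) := (hfg.const_mul _).add (hg'.const_mul _)
  have hbound : ∫ p : X × Y, (L * (2 * R) ^ l * (f p.1 * g p.2) + M * A * g p.2 + M * B * f p.1)
      ∂μ.prod ν = L * (2 * R) ^ l + M * A + M * B := by
    rw [integral_add hsum (hf'.const_mul _),
      integral_add (hfg.const_mul _) (hg'.const_mul _), integral_const_mul, integral_const_mul,
      integral_const_mul, hfg1, hf1', hg1', mul_one, mul_one, mul_one]
  rw [hdiff, ← hbound, ← Real.norm_eq_abs]
  refine norm_integral_le_of_norm_le (hsum.add (hf'.const_mul _)) ?_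
  filter_upwards [Measure.quasiMeasurePreserving_fst.ae hfA,
    Measure.quasiMeasurePreserving_snd.ae hgB] with p hpA hpB
  have hfp := hf p.1
  have hgp := hg p.2
  rw [Real.norm_eq_abs, abs_mul, abs_of_nonneg (mul_nonneg hfp hgp)]
  have hmain : 0 ≤ L * (2 * R) ^ l * (f p.1 * g p.2) := by positivity
  have hMA : 0 ≤ M * A * g p.2 := by positivity
  have hMB : 0 ≤ M * B * f p.1 := by positivity
  by_cases h1 : R < a p.1
  · have : |t p - s| * (f p.1 * g p.2) ≤ M * (A * g p.2) := by
      gcongr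
      exacts [htM p, hpA h1]
    linarith
  by_cases h2 : R < b p.2
  · have : |t p - s| * (f p.1 * g p.2) ≤ M * (f p.1 * B) := by
      gcongr
      exacts [htM p, hpB h2]
    linarith
  have hab : 0 ≤ a p.1 + b p.2 := add_nonneg (ha _) (hb _)
  have : |t p - s| * (f p.1 * g p.2) ≤ L * (2 * R) ^ l * (f p.1 * g p.2) := by
    refine mul_le_mul_of_nonneg_right ((htL p).trans ?_) (mul_nonneg hfp hgp)
    gcongr
    linarith
  linarith

/-- Hölder continuity with respect to a continuous cost vanishing on the diagonal implies
continuity. -/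
theorem continuous_of_abs_sub_le_rpow_cost {X : Type*} [TopologicalSpace X] {c t : X → X → ℝ}
    {L l : ℝ} (hl : 0 < l) (hc : Continuous (fun p : X × X => c p.1 p.2)) (hc0 : ∀ x, c x x = 0)
    (ht : ∀ x x' y y' : X, |t x' y' - t x y| ≤ L * (c x x' + c y y') ^ l) :
    Continuous (fun p : X × X => t p.1 p.2) := by
  rw [continuous_iff_continuousAt]
  rintro ⟨x, y⟩
  have hcx : Continuous (fun z => c x z) := hc.comp (Continuous.prodMk_right x)
  have hcy : Continuous (fun z => c y z) := hc.comp (Continuous.prodMk_right y)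
  have hlim : Continuous (fun p : X × X => L * (c x p.1 + c y p.2) ^ l) :=
    continuous_const.mul (((hcx.comp continuous_fst).add (hcy.comp continuous_snd)).rpow_const
      fun _ => Or.inr hl.le)
  rw [ContinuousAt, tendsto_iff_dist_tendsto_zero]
  refine squeeze_zero (fun _ => dist_nonneg) (fun p => ht x p.1 y p.2) ?_
  simpa [hc0, Real.zero_rpow hl.ne'] using hlim.tendsto (x, y)

/-- **Convergence of the regularized kernel `t^ε` to `t` as `ε → 0`.**
There exist `C > 0` and `ε₀ ∈ (0, e⁻¹]`, depending only on the Hölder constants `L, l`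
of `t`, the uniform bound `M_t` on `|t|`, `Lip(c)` and the constants of Assumption (A2)
for `μ` and `ν`, such that for every `ε ∈ (0, ε₀]`, all symmetric Schrödinger potentials,
and all `x ∈ spt(μ)`, `y ∈ spt(ν)`:
`|t^ε(x,y) - t(x,y)| ≤ C (ε log(1/ε))^l`, and hence also
`‖t^ε - t‖_{L²(μ⊗ν)} ≤ C (ε log(1/ε))^l`. -/
theorem regularized_kernel_converges
    (L l Mt Lc Cμ Dμ δμ Cν Dν δν : ℝ)
    (hL : 0 < L) (hl : 0 < l) (hMt : 0 ≤ Mt) (hLc : 0 < Lc)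
    (hCμ0 : 0 < Cμ) (hCμ1 : Cμ ≤ 1) (hDμ : 0 < Dμ) (hδμ : 0 < δμ)
    (hCν0 : 0 < Cν) (hCν1 : Cν ≤ 1) (hDν : 0 < Dν) (hδν : 0 < δν) :
    ∃ C ε₀ : ℝ, 0 < C ∧ 0 < ε₀ ∧ ε₀ ≤ Real.exp (-1) ∧
      ∀ (X : Type) [MetricSpace X] [CompactSpace X] [MeasurableSpace X] [BorelSpace X]
        (c : X → X → ℝ), Continuous (fun p : X × X => c p.1 p.2) →
        (∀ x y, c x y = c y x) → (∀ x y, 0 ≤ c x y) → (∀ x, c x x = 0) →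
        (∀ x x' y, |c x y - c x' y| ≤ Lc * dist x x') →
        ∀ (μ ν : Measure X) [IsProbabilityMeasure μ] [IsProbabilityMeasure ν],
        (∀ δ : ℝ, 0 < δ → δ ≤ δμ → ∀ x ∈ mSupport μ,
          ENNReal.ofReal (Cμ * Real.rpow δ Dμ) ≤ μ (Metric.ball x δ)) →
        (∀ δ : ℝ, 0 < δ → δ ≤ δν → ∀ y ∈ mSupport ν,
          ENNReal.ofReal (Cν * Real.rpow δ Dν) ≤ ν (Metric.ball y δ)) →
        ∀ t : X → X → ℝ, Measurable (fun p : X × X => t p.1 p.2) →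
          (∀ x y, |t x y| ≤ Mt) →
          (∀ x x' y y' : X, |t x' y' - t x y| ≤ L * Real.rpow (c x x' + c y y') l) →
        ∀ ε : ℝ, 0 < ε → ε ≤ ε₀ →
        ∀ αμ αν : X → ℝ,
          IsSymSchrodingerPotential ε c μ αμ → IsSymSchrodingerPotential ε c ν αν →
        ∀ kμ kν : X → X → ℝ,
          (∀ x y, kμ x y = Real.exp ((αμ x + αμ y - c x y) / ε)) →
          (∀ x y, kν x y = Real.exp ((αν x + αν y - c x y) / ε)) →
          (∀ y, ∫ x, kμ x y ∂μ = 1) → (∀ y, ∫ x, kν x y ∂ν = 1) →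
        (∀ x ∈ mSupport μ, ∀ y ∈ mSupport ν,
          |(∫ x', ∫ y', t x' y' * kμ x x' * kν y y' ∂ν ∂μ) - t x y|
            ≤ C * Real.rpow (ε * Real.log (1 / ε)) l) ∧
        eLpNorm (fun p : X × X =>
            (∫ x', ∫ y', t x' y' * kμ p.1 x' * kν p.2 y' ∂ν ∂μ) - t p.1 p.2) 2 (μ.prod ν)
          ≤ ENNReal.ofReal (C * Real.rpow (ε * Real.log (1 / ε)) l) := by
  have hE := Real.exp_pos (2 * Lc)
  have hK : 0 < Dμ + Dν + l := by positivity
  refine ⟨L * (2 * (Dμ + Dν + l)) ^ l + 2 * Mt * (Real.exp (2 * Lc) / Cμ)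
    + 2 * Mt * (Real.exp (2 * Lc) / Cν), min (Real.exp (-1)) (min δμ δν), by positivity,
    lt_min (Real.exp_pos _) (lt_min hδμ hδν), min_le_left _ _, ?_⟩
  intro X _ _ _ _ c hc hsymm hc_nonneg hc0 hLip μ ν _ _ hμ hν t _ htM htL ε hε hε₀ αμ αν hαμ hαν
    kμ kν hkμ hkν hkμ1 hkν1
  obtain rfl : kμ = fun x y => Real.exp ((αμ x + αμ y - c x y) / ε) := by ext; exact hkμ _ _
  obtain rfl : kν = fun x y => Real.exp ((αν x + αν y - c x y) / ε) := by ext; exact hkν _ _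
  obtain ⟨hεe, hε₁⟩ := le_min_iff.1 hε₀
  obtain ⟨hεμ, hεν⟩ := le_min_iff.1 hε₁
  have hε1 : ε ≤ 1 := hεe.trans (Real.exp_le_one_iff.2 (by norm_num))
  have hlog : 1 ≤ Real.log (1 / ε) := by
    rw [one_div, Real.log_inv, le_neg]
    exact (Real.log_le_iff_le_exp hε).2 hεe
  have hs : ε ≤ ε * Real.log (1 / ε) := le_mul_of_one_le_right hε.le hlog
  have hpow : ε ^ l ≤ (ε * Real.log (1 / ε)) ^ l := Real.rpow_le_rpow hε.le hs hl.le
  have htcont := continuous_of_abs_sub_le_rpow_cost hl hc hc0 htL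
  have hker : ∀ α : X → ℝ, Continuous α → ∀ x,
      Continuous (fun x' => Real.exp ((α x + α x' - c x x') / ε)) := fun α hα x => by
    have : Continuous (fun y => c x y) := hc.comp (Continuous.prodMk_right x)
    fun_prop
  have hflip : ∀ (α : X → ℝ) x, (fun x' => Real.exp ((α x + α x' - c x x') / ε))
      = fun x' => Real.exp ((α x' + α x - c x' x) / ε) := fun α x => by
    ext x'
    rw [add_comm, hsymm]
  have hpoint : ∀ x ∈ mSupport μ, ∀ y ∈ mSupport ν,
      |(∫ x', ∫ y', t x' y' * Real.exp ((αμ x + αμ x' - c x x') / ε)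
        * Real.exp ((αν y + αν y' - c y y') / ε) ∂ν ∂μ) - t x y|
        ≤ (L * (2 * (Dμ + Dν + l)) ^ l + 2 * Mt * (Real.exp (2 * Lc) / Cμ)
          + 2 * Mt * (Real.exp (2 * Lc) / Cν)) * (ε * Real.log (1 / ε)) ^ l := by
    intro x hx y hy
    have hf := hker αμ hαμ.1 x
    have hg := hker αν hαν.1 y
    have hti : Integrable (fun p : X × X => t p.1 p.2 * (Real.exp ((αμ x + αμ p.1 - c x p.1) / ε)
        * Real.exp ((αν y + αν p.2 - c y p.2) / ε))) (μ.prod ν) :=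
      Continuous.integrable_of_compactSpace
        (htcont.mul ((hf.comp continuous_fst).mul (hg.comp continuous_snd)))
    have hest := abs_integral_mul_mul_sub_le (μ := μ) (ν := ν) (t := fun p => t p.1 p.2)
      (f := fun x' => Real.exp ((αμ x + αμ x' - c x x') / ε))
      (g := fun y' => Real.exp ((αν y + αν y' - c y y') / ε))
      (a := c x) (b := c y) (s := t x y) (L := L) (l := l) (M := 2 * Mt)
      (R := (Dμ + Dν + l) * (ε * Real.log (1 / ε)))
      (A := Real.exp (2 * Lc) / Cμ * ε ^ l) (B := Real.exp (2 * Lc) / Cν * ε ^ l)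
      hL.le hl (by positivity) (by positivity) (by positivity) (by positivity)
      (hc_nonneg x) (hc_nonneg y) (fun _ => (Real.exp_pos _).le) (fun _ => (Real.exp_pos _).le)
      hf.integrable_of_compactSpace hg.integrable_of_compactSpace
      (by rw [hflip]; exact hkμ1 x) (by rw [hflip]; exact hkν1 y) hti
      (fun p => (abs_sub _ _).trans (by linarith [htM p.1 p.2, htM x y]))
      (fun p => htL x p.1 y p.2)
      (by
        filter_upwards [mSupport_mem_ae μ] with x' hx' hfar
        exact hαμ.kernel_tail_le hε hε1 hLc hc hc0 hLip hkμ1 hCμ0 (by linarith)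
          (hμ ε hε hεμ x hx) (hμ ε hε hεμ x' hx') hfar)
      (by
        filter_upwards [mSupport_mem_ae ν] with y' hy' hfar
        exact hαν.kernel_tail_le hε hε1 hLc hc hc0 hLip hkν1 hCν0 (by linarith)
          (hν ε hε hεν y hy) (hν ε hε hεν y' hy') hfar)
    rw [integral_prod _ hti] at hest
    simp only [mul_assoc] at hest ⊢
    refine hest.trans ?_
    rw [← mul_assoc 2 (Dμ + Dν + l), Real.mul_rpow (by positivity) (by positivity)]
    have h1 : 2 * Mt * (Real.exp (2 * Lc) / Cμ * ε ^ l)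
        ≤ 2 * Mt * (Real.exp (2 * Lc) / Cμ * (ε * Real.log (1 / ε)) ^ l) := by gcongr
    have h2 : 2 * Mt * (Real.exp (2 * Lc) / Cν * ε ^ l)
        ≤ 2 * Mt * (Real.exp (2 * Lc) / Cν * (ε * Real.log (1 / ε)) ^ l) := by gcongr
    linarith
  refine ⟨hpoint, ?_⟩
  refine (eLpNorm_le_of_ae_bound ?_).trans (by rw [measure_univ, ENNReal.one_rpow, one_mul])
  filter_upwards [Measure.quasiMeasurePreserving_fst.ae (mSupport_mem_ae μ),
    Measure.quasiMeasurePreserving_snd.ae (mSupport_mem_ae ν)] with p hp1 hp2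
  exact hpoint p.1 hp1 p.2 hp2
end

section
/- Let (X,d) be a compact metric space with its Borel σ-algebra, μ, ρ_μ, ν, ρ_ν probability measures on X, and φ^μ, φ^ν : X → X Borel maps with φ^μ_#μ = ρ_μ and φ^ν_#ν = ρ_ν. Define the linear isometries E_μ : L²(ρ_μ) → L²(μ), u ↦ u ∘ φ^μ, and E_ν : L²(ρ_ν) → L²(ν), v ↦ v ∘ φ^ν. Let S : L²(ρ_μ) → L²(ρ_ν) be a bounded linear operator and set A := E_ν ∘ S ∘ E_μ* : L²(μ) → L²(ν). Then for every λ > 0: (i) nonzero u ∈ L²(ρ_μ) and v ∈ L²(ρ_ν) satisfy S u = λ·v and S* v = λ·u if and only if E_μ u and E_ν v satisfy A (E_μ u) = λ·(E_ν v) and A* (E_ν v) = λ·(E_μ u); (ii) whenever nonzero w ∈ L²(μ) and w′ ∈ L²(ν) satisfy A w = λ·w′ and A* w′ = λ·w, there exist u ∈ L²(ρ_μ) and v ∈ L²(ρ_ν) with w = E_μ u, w′ = E_ν v, S u = λ·v and S* v = λ·u. In particular, λ > 0 is a singular value of S if and only if it is a singular value of A. -/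
open MeasureTheory
open scoped ENNReal

/-- The adjoint of composition with a measure-preserving map on `L²` is a left inverse of it. -/
theorem adjoint_apply_self_of_ae_eq_comp {X Y : Type*} [MeasurableSpace X] [MeasurableSpace Y]
    {μ : Measure X} {ρ : Measure Y} {φ : X → Y} (hφ : MeasurePreserving φ μ ρ)
    (E : Lp ℝ 2 ρ →L[ℝ] Lp ℝ 2 μ)
    (hE : ∀ u : Lp ℝ 2 ρ, (E u : X → ℝ) =ᵐ[μ] fun x => u (φ x)) (u : Lp ℝ 2 ρ) :
    ContinuousLinearMap.adjoint E (E u) = u := by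
  have hnorm : ∀ u, ‖E u‖ = ‖u‖ := fun u => by
    rw [Lp.norm_def, Lp.norm_def, eLpNorm_congr_ae (hE u)]
    exact congrArg ENNReal.toReal
      (eLpNorm_comp_measurePreserving (Lp.aestronglyMeasurable u) hφ)
  exact DFunLike.congr_fun ((ContinuousLinearMap.norm_map_iff_adjoint_comp_self E).1 hnorm) u

section SingularPairs

variable {H₁ H₂ K₁ K₂ : Type*}
  [NormedAddCommGroup H₁] [InnerProductSpace ℝ H₁] [CompleteSpace H₁]
  [NormedAddCommGroup H₂] [InnerProductSpace ℝ H₂] [CompleteSpace H₂]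
  [NormedAddCommGroup K₁] [InnerProductSpace ℝ K₁] [CompleteSpace K₁]
  [NormedAddCommGroup K₂] [InnerProductSpace ℝ K₂] [CompleteSpace K₂]

/-- `u` and `v` satisfy the equations of right and left singular vectors of `S` for `lam`. -/
def IsSingularPair (S : H₁ →L[ℝ] H₂) (lam : ℝ) (u : H₁) (v : H₂) : Prop :=
  S u = lam • v ∧ ContinuousLinearMap.adjoint S v = lam • u

variable {E : H₁ →L[ℝ] K₁} {F : H₂ →L[ℝ] K₂}

theorem isSingularPair_comp_adjoint_iff
    (hE : ∀ u, ContinuousLinearMap.adjoint E (E u) = u)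
    (hF : ∀ v, ContinuousLinearMap.adjoint F (F v) = v)
    (S : H₁ →L[ℝ] H₂) (lam : ℝ) (u : H₁) (v : H₂) :
    IsSingularPair (F ∘L S ∘L ContinuousLinearMap.adjoint E) lam (E u) (F v) ↔
      IsSingularPair S lam u v := by
  have hEi : Function.Injective E := Function.LeftInverse.injective hE
  have hFi : Function.Injective F := Function.LeftInverse.injective hF
  simp only [IsSingularPair, ContinuousLinearMap.adjoint_comp,
    ContinuousLinearMap.adjoint_adjoint, ContinuousLinearMap.comp_apply, hE, hF, ← map_smul,
    hEi.eq_iff, hFi.eq_iff]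

/-- Singular pairs of `F S E*` for a nonzero value lie in the ranges of `E` and `F`. -/
theorem IsSingularPair.exists_of_comp_adjoint
    (hE : ∀ u, ContinuousLinearMap.adjoint E (E u) = u)
    (hF : ∀ v, ContinuousLinearMap.adjoint F (F v) = v)
    {S : H₁ →L[ℝ] H₂} {lam : ℝ} (hlam : lam ≠ 0) {w : K₁} {w' : K₂}
    (h : IsSingularPair (F ∘L S ∘L ContinuousLinearMap.adjoint E) lam w w') :
    ∃ u v, w = E u ∧ w' = F v ∧ IsSingularPair S lam u v := by
  have hw : w = E (lam⁻¹ • ContinuousLinearMap.adjoint S (ContinuousLinearMap.adjoint F w')) := by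
    have h₂ := h.2
    simp only [ContinuousLinearMap.adjoint_comp, ContinuousLinearMap.adjoint_adjoint,
      ContinuousLinearMap.comp_apply] at h₂
    rw [map_smul, h₂, inv_smul_smul₀ hlam]
  have hw' : w' = F (lam⁻¹ • S (ContinuousLinearMap.adjoint E w)) := by
    have h₁ := h.1
    simp only [ContinuousLinearMap.comp_apply] at h₁
    rw [map_smul, h₁, inv_smul_smul₀ hlam]
  refine ⟨_, _, hw, hw', ?_⟩
  rw [← isSingularPair_comp_adjoint_iff hE hF, ← hw, ← hw']
  exact h

end SingularPairs

/-- **Singular value correspondence under isometric embeddings by measure-preserving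
maps.**  If `φ^μ` pushes `μ` to `ρ_μ`, `φ^ν` pushes `ν` to `ρ_ν`, and `E_μ`, `E_ν` are
the composition isometries, then for `A = E_ν ∘ S ∘ E_μ*` the positive singular values
and the corresponding pairs of singular functions of `S` and `A` are in one-to-one
correspondence via `E_μ`, `E_ν`. -/
theorem singular_value_correspondence_extension
    {X : Type*} [MetricSpace X] [CompactSpace X] [MeasurableSpace X] [BorelSpace X]
    (μ ρμ ν ρν : Measure X) [IsProbabilityMeasure μ] [IsProbabilityMeasure ρμ]
    [IsProbabilityMeasure ν] [IsProbabilityMeasure ρν]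
    (φμ φν : X → X) (hφμ : Measurable φμ) (hφν : Measurable φν)
    (hpushμ : μ.map φμ = ρμ) (hpushν : ν.map φν = ρν)
    (Eμ : Lp ℝ 2 ρμ →L[ℝ] Lp ℝ 2 μ) (Eν : Lp ℝ 2 ρν →L[ℝ] Lp ℝ 2 ν)
    (hEμ : ∀ u : Lp ℝ 2 ρμ, (Eμ u : X → ℝ) =ᵐ[μ] fun x => u (φμ x))
    (hEν : ∀ v : Lp ℝ 2 ρν, (Eν v : X → ℝ) =ᵐ[ν] fun x => v (φν x))
    (S : Lp ℝ 2 ρμ →L[ℝ] Lp ℝ 2 ρν)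
    (A : Lp ℝ 2 μ →L[ℝ] Lp ℝ 2 ν)
    (hA : A = Eν ∘L S ∘L ContinuousLinearMap.adjoint Eμ) :
    ∀ lam : ℝ, 0 < lam →
      (∀ u : Lp ℝ 2 ρμ, u ≠ 0 → ∀ v : Lp ℝ 2 ρν, v ≠ 0 →
        ((S u = lam • v ∧ ContinuousLinearMap.adjoint S v = lam • u) ↔
          (A (Eμ u) = lam • Eν v ∧
            ContinuousLinearMap.adjoint A (Eν v) = lam • Eμ u))) ∧
      (∀ w : Lp ℝ 2 μ, w ≠ 0 → ∀ w' : Lp ℝ 2 ν, w' ≠ 0 →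
        A w = lam • w' → ContinuousLinearMap.adjoint A w' = lam • w →
        ∃ (u : Lp ℝ 2 ρμ) (v : Lp ℝ 2 ρν), w = Eμ u ∧ w' = Eν v ∧
          S u = lam • v ∧ ContinuousLinearMap.adjoint S v = lam • u) ∧
      ((∃ (u : Lp ℝ 2 ρμ) (v : Lp ℝ 2 ρν), u ≠ 0 ∧ v ≠ 0 ∧
          S u = lam • v ∧ ContinuousLinearMap.adjoint S v = lam • u) ↔
        (∃ (w : Lp ℝ 2 μ) (w' : Lp ℝ 2 ν), w ≠ 0 ∧ w' ≠ 0 ∧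
          A w = lam • w' ∧ ContinuousLinearMap.adjoint A w' = lam • w)) := by
  have hEμ' := adjoint_apply_self_of_ae_eq_comp ⟨hφμ, hpushμ⟩ Eμ hEμ
  have hEν' := adjoint_apply_self_of_ae_eq_comp ⟨hφν, hpushν⟩ Eν hEν
  subst hA
  intro lam hlam
  refine ⟨fun u _ v _ => (isSingularPair_comp_adjoint_iff hEμ' hEν' S lam u v).symm,
    fun w _ w' _ h₁ h₂ =>
      IsSingularPair.exists_of_comp_adjoint hEμ' hEν' hlam.ne' ⟨h₁, h₂⟩, ?_, ?_⟩
  · rintro ⟨u, v, hu, hv, h⟩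
    exact ⟨Eμ u, Eν v,
      (map_ne_zero_iff Eμ (Function.LeftInverse.injective hEμ')).2 hu,
      (map_ne_zero_iff Eν (Function.LeftInverse.injective hEν')).2 hv,
      (isSingularPair_comp_adjoint_iff hEμ' hEν' S lam u v).2 h⟩
  · rintro ⟨w, w', hw, hw', h⟩
    obtain ⟨u, v, rfl, rfl, huv⟩ :=
      IsSingularPair.exists_of_comp_adjoint hEμ' hEν' hlam.ne' h
    exact ⟨u, v, fun hu => hw (by rw [hu, map_zero]), fun hv => hw' (by rw [hv, map_zero]),
      huv⟩
end

section
/- Let X = ℝ with the Euclidean metric, c(x,y) := (x−y)², ε > 0, ν := (1/2)·(δ₀ + δ₁), ς := 1/(1 + exp(1/ε)), and a := −(ε/2)·log((1 + exp(−1/ε))/2). Then the constant function ᾱ ≡ a satisfies the symmetric Schrödinger fixed-point equation ᾱ(x) = −ε·log( ∫ exp((ᾱ(y) − c(x,y))/ε) dν(y) ) at both points x = 0 and x = 1, and the associated kernel k(y,y′) := exp((2a − c(y,y′))/ε) satisfies k(0,0) = k(1,1) = 2·(1−ς) and k(0,1) = k(1,0) = 2·ς. In particular the measure k·(ν⊗ν)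 is a probability measure on ℝ² with both marginals equal to ν. -/
open MeasureTheory
open scoped ENNReal

/-- A density whose sections in the second variable integrate to `1` has first marginal `μ`. -/
theorem map_fst_withDensity_prod_s19 {α β : Type*} [MeasurableSpace α] [MeasurableSpace β]
    (μ : Measure α) (ν : Measure β) [SFinite μ] [SFinite ν] {g : α × β → ℝ≥0∞}
    (hg : Measurable g) (h : ∀ᵐ x ∂μ, ∫⁻ y, g (x, y) ∂ν = 1) :
    ((μ.prod ν).withDensity g).map Prod.fst = μ := by
  ext s hs
  rw [Measure.map_apply measurable_fst hs, withDensity_apply _ (measurable_fst hs),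
    ← Set.prod_univ, ← Measure.prod_restrict, Measure.restrict_univ,
    lintegral_prod _ hg.aemeasurable, lintegral_congr_ae (ae_restrict_of_ae h)]
  simp

/-- A density whose sections in the first variable integrate to `1` has second marginal `ν`. -/
theorem map_snd_withDensity_prod_s19 {α β : Type*} [MeasurableSpace α] [MeasurableSpace β]
    (μ : Measure α) (ν : Measure β) [SFinite μ] [SFinite ν] {g : α × β → ℝ≥0∞}
    (hg : Measurable g) (h : ∀ᵐ y ∂ν, ∫⁻ x, g (x, y) ∂μ = 1) :
    ((μ.prod ν).withDensity g).map Prod.snd = ν := by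
  ext s hs
  rw [Measure.map_apply measurable_snd hs, withDensity_apply _ (measurable_snd hs),
    ← Set.univ_prod, ← Measure.prod_restrict, Measure.restrict_univ,
    lintegral_prod_symm _ hg.aemeasurable, lintegral_congr_ae (ae_restrict_of_ae h)]
  simp

/-- The Bochner integral against `½(δ₀ + δ₁)` is the average of the two values. -/
theorem integral_half_smul_dirac_add_dirac (f : ℝ → ℝ) :
    ∫ y, f y ∂((1 / 2 : ℝ≥0∞) • (Measure.dirac 0 + Measure.dirac 1 : Measure ℝ)) =
      (f 0 + f 1) / 2 := by
  rw [integral_smul_measure, integral_add_measure (integrable_dirac (by simp))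
    (integrable_dirac (by simp)), integral_dirac, integral_dirac]
  simp
  ring

/-- A function which is nonnegative at `0` and `1`, with values there summing to `2`, has
`½(δ₀ + δ₁)`-average `1`. -/
theorem lintegral_ofReal_half_smul_dirac_add_dirac {f : ℝ → ℝ} (h₀ : 0 ≤ f 0) (h₁ : 0 ≤ f 1)
    (h : f 0 + f 1 = 2) :
    ∫⁻ y, ENNReal.ofReal (f y)
      ∂((1 / 2 : ℝ≥0∞) • (Measure.dirac 0 + Measure.dirac 1 : Measure ℝ)) = 1 := by
  rw [lintegral_smul_measure, lintegral_add_measure, lintegral_dirac, lintegral_dirac,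
    ← ENNReal.ofReal_add h₀ h₁, h]
  simp [ENNReal.inv_mul_cancel]

/-- A property holds `½(δ₀ + δ₁)`-almost everywhere if it holds at `0` and at `1`. -/
theorem ae_half_smul_dirac_add_dirac {p : ℝ → Prop} (h₀ : p 0) (h₁ : p 1) :
    ∀ᵐ x ∂((1 / 2 : ℝ≥0∞) • (Measure.dirac 0 + Measure.dirac 1 : Measure ℝ)), p x := by
  apply Measure.ae_smul_measure
  rw [ae_add_measure_iff, ae_dirac_eq, ae_dirac_eq]
  exact ⟨h₀, h₁⟩

/-- **Explicit entropic self-transport of the two-point measure `ν = ½(δ₀ + δ₁)`.**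
For the quadratic cost on `ℝ`, the constant `a = -(ε/2) log((1 + e^{-1/ε})/2)` is a
symmetric Schrödinger potential for `ν` at the points `0` and `1`; the associated kernel
`k(y,y') = exp((2a - (y-y')²)/ε)` takes the values `2(1-ς)` on the diagonal and `2ς`
off the diagonal, where `ς = 1/(1 + e^{1/ε})`, and `k · (ν ⊗ ν)` is a probability
measure with both marginals equal to `ν`. -/
theorem two_point_self_transport (ε : ℝ) (hε : 0 < ε) :
    let c : ℝ → ℝ → ℝ := fun x y => (x - y) ^ 2
    let ν : Measure ℝ := (1 / 2 : ℝ≥0∞) • (Measure.dirac 0 + Measure.dirac 1)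
    let ς : ℝ := 1 / (1 + Real.exp (1 / ε))
    let a : ℝ := -(ε / 2) * Real.log ((1 + Real.exp (-1 / ε)) / 2)
    let k : ℝ → ℝ → ℝ := fun y y' => Real.exp ((2 * a - c y y') / ε)
    (a = -ε * Real.log (∫ y, Real.exp ((a - c 0 y) / ε) ∂ν)) ∧
    (a = -ε * Real.log (∫ y, Real.exp ((a - c 1 y) / ε) ∂ν)) ∧
    k 0 0 = 2 * (1 - ς) ∧ k 1 1 = 2 * (1 - ς) ∧
    k 0 1 = 2 * ς ∧ k 1 0 = 2 * ς ∧
    IsProbabilityMeasure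
      ((ν.prod ν).withDensity fun p => ENNReal.ofReal (k p.1 p.2)) ∧
    ((ν.prod ν).withDensity fun p => ENNReal.ofReal (k p.1 p.2)).map Prod.fst = ν ∧
    ((ν.prod ν).withDensity fun p => ENNReal.ofReal (k p.1 p.2)).map Prod.snd = ν := by
  intro c ν ς a k
  set q : ℝ := Real.exp (-1 / ε) with hq
  have ha : a = -(ε / 2) * Real.log ((1 + q) / 2) := rfl
  have hq0 : 0 < q := Real.exp_pos _
  have hinv : Real.exp (1 / ε) = q⁻¹ := by rw [hq, ← Real.exp_neg]; ring_nf
  have hς : ς = q / (1 + q) := by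
    simp only [ς, hinv]
    field_simp
    ring
  have hexp : Real.exp (2 * a / ε) = 2 / (1 + q) := by
    have : 2 * a / ε = -Real.log ((1 + q) / 2) := by
      rw [ha]
      field_simp
    rw [this, Real.exp_neg, Real.exp_log (by positivity), inv_div]
  have hdiag : 2 / (1 + q) = 2 * (1 - ς) := by
    rw [hς]
    field_simp
    ring
  have hoff : Real.exp ((2 * a - 1) / ε) = 2 * ς := by
    rw [show (2 * a - 1) / ε = 2 * a / ε + -1 / ε by ring, Real.exp_add, hexp, hς]
    ring
  have k00 : k 0 0 = 2 * (1 - ς) := by simp [k, c, hexp, hdiag]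
  have k11 : k 1 1 = 2 * (1 - ς) := by simp [k, c, hexp, hdiag]
  have k01 : k 0 1 = 2 * ς := by simp [k, c, hoff]
  have k10 : k 1 0 = 2 * ς := by simp [k, c, hoff]
  have hpot : a = -ε * Real.log (Real.exp (a / ε) * ((1 + q) / 2)) := by
    rw [Real.log_mul (Real.exp_ne_zero _) (by positivity), Real.log_exp]
    rw [ha]
    field_simp
    ring
  have hshift : Real.exp ((a - 1) / ε) = Real.exp (a / ε) * q := by
    rw [hq, ← Real.exp_add]
    ring_nf
  have hk0 : ∀ x y, 0 ≤ k x y := fun x y => (Real.exp_pos _).le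
  have hmeas : Measurable fun p : ℝ × ℝ => ENNReal.ofReal (k p.1 p.2) := by
    simp only [k, c]
    fun_prop
  have hνu : ν Set.univ = 1 := by
    simp only [ν, Measure.smul_apply, Measure.add_apply, measure_univ, smul_eq_mul,
      one_add_one_eq_two]
    simp [ENNReal.inv_mul_cancel]
  have : IsProbabilityMeasure ν := ⟨hνu⟩
  have hfst : ((ν.prod ν).withDensity fun p => ENNReal.ofReal (k p.1 p.2)).map Prod.fst = ν :=
    map_fst_withDensity_prod_s19 ν ν hmeas <| ae_half_smul_dirac_add_dirac
      (lintegral_ofReal_half_smul_dirac_add_dirac (hk0 _ _) (hk0 _ _) (by rw [k00, k01]; ring))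
      (lintegral_ofReal_half_smul_dirac_add_dirac (hk0 _ _) (hk0 _ _) (by rw [k10, k11]; ring))
  have hsnd : ((ν.prod ν).withDensity fun p => ENNReal.ofReal (k p.1 p.2)).map Prod.snd = ν :=
    map_snd_withDensity_prod_s19 ν ν hmeas <| ae_half_smul_dirac_add_dirac
      (lintegral_ofReal_half_smul_dirac_add_dirac (f := fun x => k x 0) (hk0 _ _) (hk0 _ _)
        (by simp only [k00, k10]; ring))
      (lintegral_ofReal_half_smul_dirac_add_dirac (f := fun x => k x 1) (hk0 _ _) (hk0 _ _)
        (by simp only [k01, k11]; ring))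
  refine ⟨?_, ?_, k00, k11, k01, k10, ⟨?_⟩, hfst, hsnd⟩
  · rw [integral_half_smul_dirac_add_dirac]
    convert hpot using 3
    simp only [c, sub_self, zero_sub, neg_sq, one_pow, ne_eq, OfNat.ofNat_ne_zero,
      not_false_eq_true, zero_pow, sub_zero, hshift]
    ring
  · rw [integral_half_smul_dirac_add_dirac]
    convert hpot using 3
    simp only [c, sub_self, one_pow, ne_eq, OfNat.ofNat_ne_zero,
      not_false_eq_true, zero_pow, sub_zero, hshift]
    ring
  · rw [← hνu, ← hfst, Measure.map_apply measurable_fst MeasurableSet.univ, Set.preimage_univ, hfst]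
end
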